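/- arXiv:math/0602312 — 4 statements merged into one kernel-verified Lean document; each statement's English description precedes it below -/
import Mathlib

section
/- A C*-algebra A with property T (every A–A bimodule admitting a sequence of almost central unit vectors has a nonzero central vector), satisfying: every finite-dimensional irreducible representation π : A → M_n(ℂ) that is weakly contained in a representation σ (in the sense that there exist isometries V_k : ℂ^n → K with ‖σ(a)V_k − V_kπ(a)‖ → 0 for all a) is unitarily equivalent to a subrepresentation of σ. -/
open Filter MulOpposite ContinuousLinearMap

/-- Bekka's property T for a unital C*-algebra `A`: every `A`–`A` bimodule (a Hilbert space
with commuting unital left `A`- and right `Aᵒᵖ`-actions) admitting a sequence of almost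
central unit vectors has a nonzero central vector. -/
def PropertyT (A : Type*) [Ring A] [StarRing A] [Algebra ℂ A] : Prop :=
  ∀ (H : Type) [NormedAddCommGroup H] [InnerProductSpace ℂ H] [CompleteSpace H]
    (L : A →⋆ₐ[ℂ] (H →L[ℂ] H)) (R : Aᵐᵒᵖ →⋆ₐ[ℂ] (H →L[ℂ] H)),
    (∀ (a : A) (b : Aᵐᵒᵖ), Commute (L a) (R b)) →
    (∃ ξ : ℕ → H, (∀ n, ‖ξ n‖ = 1) ∧
      ∀ a : A, Tendsto (fun n => ‖L a (ξ n) - R (op a) (ξ n)‖) atTop (nhds 0)) →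
    ∃ ξ : H, ξ ≠ 0 ∧ ∀ a : A, L a ξ = R (op a) ξ

section helpers

variable {A : Type*} [Ring A] [StarRing A] [Algebra ℂ A] {n : ℕ}
  {K : Type} [NormedAddCommGroup K] [InnerProductSpace ℂ K] [CompleteSpace K]

local notation "𝓔" => EuclideanSpace ℂ (Fin n)

/-- Left action on Hilbert-Schmidt operators. -/
noncomputable def hsL (T : K →L[ℂ] K) :
    PiLp 2 (fun _ : Fin n => K) →L[ℂ] PiLp 2 (fun _ : Fin n => K) where
  toFun ξ := WithLp.toLp 2 fun i => T (ξ i)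
  map_add' ξ η := by ext i; simp
  map_smul' c ξ := by ext i; simp
  cont := by fun_prop

/-- Right action on Hilbert-Schmidt operators. -/
noncomputable def hsR (T : 𝓔 →L[ℂ] 𝓔) :
    PiLp 2 (fun _ : Fin n => K) →L[ℂ] PiLp 2 (fun _ : Fin n => K) where
  toFun ξ := WithLp.toLp 2 fun j => ∑ i, (T (EuclideanSpace.single j 1)) i • ξ i
  map_add' ξ η := by ext i; simp [Finset.sum_add_distrib]
  map_smul' c ξ := by
    ext i
    simp only [PiLp.smul_apply, RingHom.id_apply, Finset.smul_sum]
    exact Finset.sum_congr rfl fun j _ => smul_comm _ _ _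
  cont := by fun_prop

theorem hsL_apply (T : K →L[ℂ] K) (ξ : PiLp 2 (fun _ : Fin n => K)) (i : Fin n) :
    hsL T ξ i = T (ξ i) := rfl

theorem hsR_apply (T : 𝓔 →L[ℂ] 𝓔) (ξ : PiLp 2 (fun _ : Fin n => K)) (j : Fin n) :
    hsR T ξ j = ∑ i, (T (EuclideanSpace.single j 1)) i • ξ i := rfl

/-- The operator of a tuple. -/
noncomputable def hsOp (ξ : PiLp 2 (fun _ : Fin n => K)) : 𝓔 →L[ℂ] K where
  toFun x := ∑ i, x i • ξ i
  map_add' x y := by simp [add_smul, Finset.sum_add_distrib]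
  map_smul' c x := by simp [mul_smul, Finset.smul_sum]
  cont := by fun_prop

theorem hsOp_apply (ξ : PiLp 2 (fun _ : Fin n => K)) (x : 𝓔) :
    hsOp ξ x = ∑ i, x i • ξ i := rfl

theorem hsOp_single (ξ : PiLp 2 (fun _ : Fin n => K)) (j : Fin n) :
    hsOp ξ (EuclideanSpace.single j 1) = ξ j := by
  rw [hsOp_apply, Finset.sum_eq_single j] <;> simp +contextual

theorem euc_ext {T S : 𝓔 →L[ℂ] K}
    (h : ∀ j, T (EuclideanSpace.single j 1) = S (EuclideanSpace.single j 1)) : T = S := by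
  apply ContinuousLinearMap.coe_injective
  apply (EuclideanSpace.basisFun (Fin n) ℂ).toBasis.ext
  intro j
  simpa using h j

theorem hsOp_hsR (T : 𝓔 →L[ℂ] 𝓔) (ξ : PiLp 2 (fun _ : Fin n => K)) :
    hsOp (hsR T ξ) = (hsOp ξ).comp T := by
  apply euc_ext
  intro j
  rw [hsOp_single]
  rfl

theorem hsOp_hsL (T : K →L[ℂ] K) (ξ : PiLp 2 (fun _ : Fin n => K)) :
    hsOp (hsL T ξ) = T.comp (hsOp ξ) := by
  apply euc_ext
  intro j
  rw [hsOp_single, ContinuousLinearMap.comp_apply, hsOp_single]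
  rfl

theorem hsOp_inj {ξ η : PiLp 2 (fun _ : Fin n => K)} (h : hsOp ξ = hsOp η) : ξ = η := by
  ext i
  rw [← hsOp_single, h, hsOp_single]

theorem hsL_adj (T : K →L[ℂ] K) :
    hsL (n := n) (star T) = star (hsL T) := by
  rw [ContinuousLinearMap.star_eq_adjoint, ContinuousLinearMap.star_eq_adjoint,
    ContinuousLinearMap.eq_adjoint_iff]
  intro ξ η
  simp [PiLp.inner_apply, hsL_apply, ContinuousLinearMap.adjoint_inner_left]

theorem coord_star (T : 𝓔 →L[ℂ] 𝓔) (i j : Fin n) :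
    (star T (EuclideanSpace.single j 1)) i = star (T (EuclideanSpace.single i 1) j) := by
  have h := ContinuousLinearMap.adjoint_inner_right T (EuclideanSpace.single i 1)
    (EuclideanSpace.single j 1)
  rw [EuclideanSpace.inner_single_left, EuclideanSpace.inner_single_right] at h
  simpa [ContinuousLinearMap.star_eq_adjoint] using h

theorem hsR_adj (T : 𝓔 →L[ℂ] 𝓔) :
    hsR (K := K) (star T) = star (hsR T) := by
  refine (ContinuousLinearMap.eq_adjoint_iff _ _).2 ?_
  intro ξ η
  simp only [PiLp.inner_apply, hsR_apply, sum_inner, inner_sum, inner_smul_left, inner_smul_right,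
    coord_star]
  rw [Finset.sum_comm]
  simp

/-- Left representation. -/
noncomputable def repL (σ : A →⋆ₐ[ℂ] (K →L[ℂ] K)) (n : ℕ) :
    A →⋆ₐ[ℂ] (PiLp 2 (fun _ : Fin n => K) →L[ℂ] PiLp 2 (fun _ : Fin n => K)) where
  toFun a := hsL (σ a)
  map_one' := by ext ξ i; simp [hsL_apply]
  map_mul' a b := by ext ξ i; simp [hsL_apply]
  map_zero' := by ext ξ i; simp [hsL_apply]
  map_add' a b := by ext ξ i; simp [hsL_apply]
  commutes' c := by ext ξ i; simp [hsL_apply, Algebra.algebraMap_eq_smul_one]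
  map_star' a := by rw [map_star, hsL_adj]

/-- Right representation. -/
noncomputable def repR (π : A →⋆ₐ[ℂ] (𝓔 →L[ℂ] 𝓔)) (K : Type) [NormedAddCommGroup K]
    [InnerProductSpace ℂ K] [CompleteSpace K] :
    Aᵐᵒᵖ →⋆ₐ[ℂ] (PiLp 2 (fun _ : Fin n => K) →L[ℂ] PiLp 2 (fun _ : Fin n => K)) where
  toFun a := hsR (π a.unop)
  map_one' := by
    ext1 ξ; apply hsOp_inj; rw [hsOp_hsR]; ext x; simp
  map_mul' a b := by
    ext1 ξ; apply hsOp_inj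
    simp only [mul_apply_eq_comp, ContinuousLinearMap.comp_apply, hsOp_hsR]; ext x; simp
  map_zero' := by ext ξ i; simp [hsR_apply]
  map_add' a b := by ext ξ i; simp [hsR_apply, add_smul, Finset.sum_add_distrib]
  commutes' c := by
    ext1 ξ; apply hsOp_inj; rw [hsOp_hsR]; ext x
    simp [Algebra.algebraMap_eq_smul_one, hsOp_apply, Finset.smul_sum, smul_comm c]
  map_star' a := by rw [MulOpposite.unop_star, map_star, hsR_adj]

theorem rep_commute (σ : A →⋆ₐ[ℂ] (K →L[ℂ] K)) (π : A →⋆ₐ[ℂ] (𝓔 →L[ℂ] 𝓔)) (a : A) (b : Aᵐᵒᵖ) :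
    Commute (repL σ n a) (repR π K b) := by
  change hsL (σ a) * hsR (π b.unop) = hsR (π b.unop) * hsL (σ a)
  ext1 ξ
  apply hsOp_inj
  simp only [mul_apply_eq_comp, ContinuousLinearMap.comp_apply, hsOp_hsR, hsOp_hsL]
  rfl

/-- Schur argument. -/
theorem schur_iso (hn : 0 < n) (π : A →⋆ₐ[ℂ] (𝓔 →L[ℂ] 𝓔))
    (hirr : ∀ S : Submodule ℂ 𝓔, (∀ (a : A) (x : 𝓔), x ∈ S → π a x ∈ S) → S = ⊥ ∨ S = ⊤)
    (σ : A →⋆ₐ[ℂ] (K →L[ℂ] K)) (T : 𝓔 →L[ℂ] K) (hT : T ≠ 0)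
    (hc : ∀ a, (σ a).comp T = T.comp (π a)) :
    ∃ W : 𝓔 →L[ℂ] K, (∀ x, ‖W x‖ = ‖x‖) ∧ ∀ a : A, W.comp (π a) = (σ a).comp W := by
  have : Nonempty (Fin n) := ⟨⟨0, hn⟩⟩
  have : Nontrivial 𝓔 := inferInstance
  set S : 𝓔 →L[ℂ] 𝓔 := (adjoint T).comp T with hS
  have hc' : ∀ a, (π a).comp (adjoint T) = (adjoint T).comp (σ a) := by
    intro a
    have h := congrArg adjoint (hc (star a))
    rw [ContinuousLinearMap.adjoint_comp, ContinuousLinearMap.adjoint_comp, map_star σ, map_star π,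
      ContinuousLinearMap.star_eq_adjoint, ContinuousLinearMap.star_eq_adjoint,
      ContinuousLinearMap.adjoint_adjoint, ContinuousLinearMap.adjoint_adjoint] at h
    exact h.symm
  have hcS : ∀ a x, S (π a x) = π a (S x) := by
    intro a x
    have h1 := DFunLike.congr_fun (hc a) x
    have h2 := DFunLike.congr_fun (hc' a) (T x)
    simp only [ContinuousLinearMap.comp_apply] at h1 h2
    simp only [hS, ContinuousLinearMap.comp_apply]
    rw [← h1, h2]
  obtain ⟨μ, hμ⟩ := Module.End.exists_eigenvalue (S : 𝓔 →ₗ[ℂ] 𝓔)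
  have htop : Module.End.eigenspace (S : 𝓔 →ₗ[ℂ] 𝓔) μ = ⊤ := by
    refine (hirr _ ?_).resolve_left hμ
    intro a x hx
    rw [Module.End.mem_eigenspace_iff] at hx ⊢
    change S x = _ at hx
    change S _ = _
    rw [hcS, hx, map_smul]
  have hSx : ∀ x, S x = μ • x := by
    intro x
    have : x ∈ Module.End.eigenspace (S : 𝓔 →ₗ[ℂ] 𝓔) μ := by rw [htop]; trivial
    exact Module.End.mem_eigenspace_iff.1 this
  have hnorm : ∀ x, ‖T x‖ ^ 2 = μ.re * ‖x‖ ^ 2 := by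
    intro x
    have h := ContinuousLinearMap.apply_norm_sq_eq_inner_adjoint_right T x
    rw [h]
    change RCLike.re (inner ℂ x (S x)) = _
    rw [hSx, inner_smul_right, inner_self_eq_norm_sq_to_K]
    change (μ * ((‖x‖ : ℝ) : ℂ) ^ 2).re = _
    rw [← Complex.ofReal_pow, Complex.re_mul_ofReal]
  obtain ⟨x, hx⟩ : ∃ x, T x ≠ 0 := by
    by_contra! h
    exact hT (ContinuousLinearMap.ext h)
  have hμ0 : 0 < μ.re := by
    have h1 : 0 < ‖T x‖ ^ 2 := by positivity
    rw [hnorm] at h1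
    exact pos_of_mul_pos_left h1 (by positivity)
  refine ⟨((Real.sqrt μ.re)⁻¹ : ℂ) • T, ?_, ?_⟩
  · intro y
    have h1 : ‖T y‖ = Real.sqrt μ.re * ‖y‖ := by
      rw [← Real.sqrt_sq (norm_nonneg (T y)), hnorm, Real.sqrt_mul hμ0.le,
        Real.sqrt_sq (norm_nonneg y)]
    have h2 : 0 < Real.sqrt μ.re := Real.sqrt_pos.2 hμ0
    rw [ContinuousLinearMap.smul_apply, norm_smul, h1, norm_inv, Complex.norm_real,
      Real.norm_of_nonneg h2.le]
    field_simp
  · intro a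
    rw [ContinuousLinearMap.smul_comp, ContinuousLinearMap.comp_smul, hc]

theorem hs_norm_le (T : 𝓔 →L[ℂ] K) :
    ‖(WithLp.toLp 2 fun i => T (EuclideanSpace.single i 1) : PiLp 2 (fun _ : Fin n => K))‖
      ≤ Real.sqrt n * ‖T‖ := by
  rw [PiLp.norm_eq_of_L2]
  calc Real.sqrt (∑ i : Fin n, ‖T (EuclideanSpace.single i 1)‖ ^ 2)
      ≤ Real.sqrt (∑ i : Fin n, ‖T‖ ^ 2) := by
        apply Real.sqrt_le_sqrt
        apply Finset.sum_le_sum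
        intro i _
        have := T.le_opNorm (EuclideanSpace.single i 1)
        simp only [EuclideanSpace.norm_single, norm_one, mul_one] at this
        gcongr
    _ = _ := by simp [Real.sqrt_sq]

end helpers

/-- If a separable unital C*-algebra `A` has property T, then every finite-dimensional
irreducible representation `π : A → M_n(ℂ) = B(ℂ^n)` which is weakly contained in a
representation `σ : A → B(K)` (i.e. there are isometries `V_k : ℂ^n → K` with
`‖σ(a)V_k − V_kπ(a)‖ → 0` for all `a`) is unitarily equivalent to a subrepresentation
of `σ`. -/
theorem propertyT_weak_containment_implies_containment
    {A : Type*} [NormedRing A] [StarRing A] [CStarRing A] [NormedAlgebra ℂ A]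
    [CompleteSpace A] [TopologicalSpace.SeparableSpace A]
    (hT : PropertyT A)
    {n : ℕ} (hn : 0 < n)
    (π : A →⋆ₐ[ℂ] (EuclideanSpace ℂ (Fin n) →L[ℂ] EuclideanSpace ℂ (Fin n)))
    (hirr : ∀ S : Submodule ℂ (EuclideanSpace ℂ (Fin n)),
      (∀ (a : A) (x : EuclideanSpace ℂ (Fin n)), x ∈ S → π a x ∈ S) → S = ⊥ ∨ S = ⊤)
    {K : Type} [NormedAddCommGroup K] [InnerProductSpace ℂ K] [CompleteSpace K]
    (σ : A →⋆ₐ[ℂ] (K →L[ℂ] K))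
    (V : ℕ → (EuclideanSpace ℂ (Fin n) →L[ℂ] K))
    (hiso : ∀ k (x : EuclideanSpace ℂ (Fin n)), ‖V k x‖ = ‖x‖)
    (hwc : ∀ a : A, Tendsto (fun k => ‖(σ a).comp (V k) - (V k).comp (π a)‖) atTop (nhds 0)) :
    ∃ W : EuclideanSpace ℂ (Fin n) →L[ℂ] K,
      (∀ x, ‖W x‖ = ‖x‖) ∧ ∀ a : A, W.comp (π a) = (σ a).comp W := by
  have hn' : (0 : ℝ) < Real.sqrt n := Real.sqrt_pos.2 (by exact_mod_cast hn)
  let v : ℕ → PiLp 2 (fun _ : Fin n => K) := fun k =>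
    WithLp.toLp 2 fun i => V k (EuclideanSpace.single i 1)
  have hv : ∀ k, hsOp (v k) = V k := by
    intro k
    apply euc_ext
    intro j
    rw [hsOp_single]
  have hvn : ∀ k, ‖v k‖ = Real.sqrt n := by
    intro k
    rw [PiLp.norm_eq_of_L2]
    simp [v, hiso]
  have hac : ∃ ξ : ℕ → PiLp 2 (fun _ : Fin n => K), (∀ k, ‖ξ k‖ = 1) ∧
      ∀ a : A, Tendsto (fun k => ‖repL σ n a (ξ k) - repR π K (op a) (ξ k)‖) atTop (nhds 0) := by
    refine ⟨fun k => ((Real.sqrt n)⁻¹ : ℂ) • v k, ?_, ?_⟩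
    · intro k
      rw [norm_smul, hvn, norm_inv, Complex.norm_real, Real.norm_of_nonneg hn'.le]
      field_simp
    · intro a
      refine squeeze_zero (fun _ => norm_nonneg _) (fun k => ?_) (hwc a)
      have h1 : repL σ n a (v k) - repR π K (op a) (v k) =
          WithLp.toLp 2 fun i =>
            ((σ a).comp (V k) - (V k).comp (π a)) (EuclideanSpace.single i 1) := by
        ext i
        have h2 : (repR π K (op a) (v k)) i = V k (π a (EuclideanSpace.single i 1)) := by
          change hsR (π a) (v k) i = _
          rw [← hsOp_single (hsR (π a) (v k)), hsOp_hsR, hv]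
          rfl
        rw [PiLp.sub_apply, h2]
        rfl
      rw [map_smul, map_smul, ← smul_sub, h1, norm_smul, norm_inv, Complex.norm_real,
        Real.norm_of_nonneg hn'.le, inv_mul_le_iff₀ hn']
      exact hs_norm_le _
  obtain ⟨ξ, hξ0, hξ⟩ := hT (PiLp 2 (fun _ : Fin n => K)) (repL σ n) (repR π K)
    (rep_commute σ π) hac
  · refine schur_iso hn π hirr σ (hsOp ξ) ?_ ?_
    · intro h
      apply hξ0
      apply hsOp_inj
      rw [h]
      ext x
      simp [hsOp_apply]
    · intro a
      have h := congrArg hsOp (hξ a)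
      change hsOp (hsL (σ a) ξ) = hsOp (hsR (π a) ξ) at h
      rwa [hsOp_hsL, hsOp_hsR] at h
end

section
/- A C*-algebra with property T has an amenable trace if and only if it has a nonzero finite-dimensional quotient. -/
open Filter Matrix MulOpposite
open scoped ComplexOrder

/-- Complete positivity for a linear map into `M_k(ℂ)`. -/
def IsCompletelyPositive {A : Type*} [Ring A] [StarRing A] [Algebra ℂ A]
    {k : ℕ} (φ : A →ₗ[ℂ] Matrix (Fin k) (Fin k) ℂ) : Prop :=
  ∀ (m : ℕ) (a : Fin m → A) (v : Fin m → Matrix (Fin k) (Fin k) ℂ),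
    (∑ i : Fin m, ∑ j : Fin m,
      (v i).conjTranspose * φ (star (a i) * a j) * v j).PosSemidef

/-- A tracial state. -/
def IsTracialState {A : Type*} [Ring A] [StarRing A] [Algebra ℂ A]
    (τ : A →ₗ[ℂ] ℂ) : Prop :=
  τ 1 = 1 ∧ (∀ a : A, 0 ≤ τ (star a * a)) ∧ ∀ a b : A, τ (a * b) = τ (b * a)

/-- The Connes–Kirchberg characterization of amenability of a trace `τ`: there are
u.c.p. maps `φ_n : A → M_{k(n)}(ℂ)` which are asymptotically multiplicative in
`‖·‖_{2,tr}` and with `tr ∘ φ_n → τ` pointwise. -/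
def IsAmenableTrace {A : Type*} [Ring A] [StarRing A] [Algebra ℂ A]
    (τ : A →ₗ[ℂ] ℂ) : Prop :=
  IsTracialState τ ∧
  ∃ (k : ℕ → ℕ) (φ : ∀ n : ℕ, A →ₗ[ℂ] Matrix (Fin (k n)) (Fin (k n)) ℂ),
    (∀ n, 0 < k n ∧ φ n 1 = 1 ∧ IsCompletelyPositive (φ n)) ∧
    (∀ a b : A, Tendsto (fun n =>
      Real.sqrt ((((φ n (a * b) - φ n a * φ n b).conjTranspose *
        (φ n (a * b) - φ n a * φ n b)).trace).re / k n)) atTop (nhds 0)) ∧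
    (∀ a : A, Tendsto (fun n => (φ n a).trace / (k n : ℂ)) atTop (nhds (τ a)))


theorem bdd_aux {A : Type*} [NormedRing A] [StarRing A] [CStarRing A] [NormedAlgebra ℂ A]
    [CompleteSpace A] (a : A) : ∃ (c : A) (N : ℕ), star a * a + star c * c = (N : A) := by
  have hd : HasStrictFDerivAt (fun c : A => c * c)
      ((ContinuousLinearEquiv.smulLeft (Units.mk0 (2:ℂ) two_ne_zero) : A ≃L[ℂ] A) : A →L[ℂ] A) 1 := by
    have := (hasStrictFDerivAt_id (𝕜 := ℂ) (1 : A)).mul' (hasStrictFDerivAt_id (𝕜 := ℂ) (1 : A))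
    refine this.congr_fderiv ?_
    ext x
    simp [two_smul, Units.smul_def]
  set g := hd.localInverse (fun c : A => c * c) _ 1 with hg
  have h1 := hd.eventually_right_inverse
  have h2 := hd.eventually_left_inverse
  have h3 := hd.localInverse_tendsto
  simp only [mul_one] at h1 h3
  have h4 : Tendsto (fun N : ℕ => (1 : A) - (((N ^ 2 : ℕ) : ℂ)⁻¹) • (star a * a)) atTop (nhds 1) := by
    have : Tendsto (fun N : ℕ => (((N ^ 2 : ℕ) : ℂ)⁻¹)) atTop (nhds 0) :=
      (tendsto_inv_atTop_nhds_zero_nat (𝕜 := ℂ)).comp (tendsto_pow_atTop two_ne_zero)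
    simpa using (tendsto_const_nhds (x := (1:A))).sub (this.smul_const (star a * a))
  have h5 : Tendsto (fun y => star (g y)) (nhds 1) (nhds (1:A)) := by
    have := (continuous_star (R := A)).tendsto 1
    rw [star_one] at this
    exact this.comp h3
  obtain ⟨N, ⟨hN1, hN2⟩, hN0⟩ := ((h4.eventually (h1.and (h5.eventually h2))).and
    (eventually_gt_atTop 0)).exists
  set y := (1 : A) - (((N ^ 2 : ℕ) : ℂ)⁻¹) • (star a * a) with hy
  have hN : ((N ^ 2 : ℕ) : ℂ) ≠ 0 := by exact_mod_cast (pow_pos hN0 2).ne'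
  have key : ∀ z : A, ((N ^ 2 : ℕ) : A) * z = ((N ^ 2 : ℕ) : ℂ) • z := by
    intro z; rw [← nsmul_eq_mul]; exact (Nat.cast_smul_eq_nsmul ℂ (N ^ 2) z).symm
  have hNy : ((N ^ 2 : ℕ) : A) * y = ((N ^ 2 : ℕ) : A) - star a * a := by
    rw [hy, mul_sub, key (_ • _), smul_smul, mul_inv_cancel₀ hN, one_smul, mul_one]
  have hsy : star y = y := by
    have e1 : ((N ^ 2 : ℕ) : A) * star y = ((N ^ 2 : ℕ) : A) * y := by
      have := congrArg star hNy
      rw [star_mul, star_natCast, ← (Nat.cast_commute (N ^ 2) (star y)).eq] at this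
      rw [this, hNy]; simp
    rw [key, key] at e1
    exact smul_right_injective A hN e1
  have hsg : star (g y) = g y := by
    have : star (g y) * star (g y) = y := by rw [← star_mul, hN1, hsy]
    rw [this] at hN2
    exact hN2.symm
  refine ⟨(N : A) * g y, N ^ 2, ?_⟩
  have hc : star ((N : A) * g y) * ((N : A) * g y) = ((N ^ 2 : ℕ) : A) * y := by
    rw [star_mul, star_natCast, hsg, ← (Nat.cast_commute N (g y)).eq]
    nth_rewrite 3 [← hN1]
    push_cast
    rw [sq, mul_assoc, ← mul_assoc (g y), ← (Nat.cast_commute N (g y)).eq]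
    simp only [mul_assoc, hg]
  rw [hc, hNy]; abel

/-- extension of an algebraic star action on a pre-Hilbert space to the completion -/
theorem extend_aux {B : Type*} [Ring B] [StarRing B] [Algebra ℂ B]
    (hb : ∀ a : B, ∃ (c : B) (N : ℕ), star a * a + star c * c = (N : B))
    {E : Type} [SeminormedAddCommGroup E] [InnerProductSpace ℂ E]
    (ρ : B →ₐ[ℂ] Module.End ℂ E)
    (hρ : ∀ a x y, inner ℂ (ρ a x) y = inner ℂ x (ρ (star a) y)) :
    ∃ L : B →⋆ₐ[ℂ] (UniformSpace.Completion E →L[ℂ] UniformSpace.Completion E),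
      ∀ a (x : E), L a (x : UniformSpace.Completion E) = ((ρ a x : E) : UniformSpace.Completion E) := by
  have hbd : ∀ a, ∃ C : ℝ, ∀ x, ‖ρ a x‖ ≤ C * ‖x‖ := by
    intro a
    obtain ⟨c, N, h⟩ := hb a
    refine ⟨Real.sqrt N, fun x => ?_⟩
    have hsq : ∀ d : B, ‖ρ d x‖ ^ 2 = (inner ℂ x (ρ (star d * d) x)).re := by
      intro d
      rw [map_mul, Module.End.mul_apply, ← hρ, ← RCLike.re_eq_complex_re, inner_self_eq_norm_sq]
    have h2 : ‖ρ a x‖ ^ 2 + ‖ρ c x‖ ^ 2 = N * ‖x‖ ^ 2 := by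
      rw [hsq, hsq, ← Complex.add_re, ← inner_add_right, ← LinearMap.add_apply, ← map_add, h,
        map_natCast, ← inner_self_eq_norm_sq (𝕜 := ℂ) x]
      have : ((N : Module.End ℂ E)) x = (N : ℂ) • x := by
        rw [Module.End.natCast_apply, Nat.cast_smul_eq_nsmul]
      rw [this, inner_smul_right]
      simp
    apply (sq_le_sq₀ (norm_nonneg _) (by positivity)).mp
    rw [mul_pow, Real.sq_sqrt (by positivity)]
    nlinarith [sq_nonneg ‖ρ c x‖]
  choose C hC using hbd
  let T : B → (E →L[ℂ] E) := fun a => (ρ a).mkContinuous (C a) (hC a)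
  have hT : ∀ a x, T a x = ρ a x := fun a x => rfl
  let M : B → (UniformSpace.Completion E →L[ℂ] UniformSpace.Completion E) := fun a => (T a).completion
  have hM : ∀ a (x : E), M a (x : UniformSpace.Completion E) = ((ρ a x : E) : UniformSpace.Completion E) := by
    intro a x
    exact UniformSpace.Completion.map_coe (T a).uniformContinuous x
  have hext : ∀ S S' : UniformSpace.Completion E →L[ℂ] UniformSpace.Completion E,
      (∀ x : E, S x = S' x) → S = S' := by
    intro S S' h
    ext x
    induction x using UniformSpace.Completion.induction_on with
    | hp => exact isClosed_eq S.continuous S'.continuous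
    | ih x => exact h x
  refine ⟨{ toFun := M, map_one' := ?_, map_mul' := ?_, map_zero' := ?_, map_add' := ?_,
            commutes' := ?_, map_star' := ?_ }, hM⟩
  · apply hext; intro x; rw [hM]; simp
  · intro a b; apply hext; intro x; rw [hM]; simp [hM]
  · apply hext; intro x; rw [hM]; simp [UniformSpace.Completion.coe_zero]
  · intro a b; apply hext; intro x; rw [hM]; simp [hM, UniformSpace.Completion.coe_add]
  · intro r; apply hext; intro x; rw [hM]
    simp [Algebra.algebraMap_eq_smul_one, UniformSpace.Completion.coe_smul]
  · intro a
    rw [ContinuousLinearMap.star_eq_adjoint, ContinuousLinearMap.eq_adjoint_iff]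
    intro x y
    induction x, y using UniformSpace.Completion.induction_on₂ with
    | hp => exact isClosed_eq (by fun_prop) (by fun_prop)
    | ih x y =>
      rw [hM, hM, UniformSpace.Completion.inner_coe, UniformSpace.Completion.inner_coe, hρ, star_star]

theorem gns_aux {B : Type*} [Ring B] [StarRing B] [Algebra ℂ B]
    (hb : ∀ a : B, ∃ (c : B) (N : ℕ), star a * a + star c * c = (N : B))
    {W : Type} [AddCommGroup W] [Module ℂ W] (e : W ≃ₗ[ℂ] B)
    {I : Type} (Φ : I → I → B →ₗ[ℂ] ℂ)
    (hsymm : ∀ i j a b, (starRingEnd ℂ) (Φ i j (star a * b)) = Φ j i (star b * a))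
    (hpos : ∀ (s : Finset I) (a : I → B), 0 ≤ (∑ i ∈ s, ∑ j ∈ s, Φ i j (star (a i) * a j)).re) :
    ∃ (K : Type) (_ : NormedAddCommGroup K) (_ : InnerProductSpace ℂ K) (_ : CompleteSpace K)
      (π : B →⋆ₐ[ℂ] (K →L[ℂ] K)) (v : I → K),
      ∀ i j a, inner ℂ (v i) (π a (v j)) = Φ i j a := by
  classical
  have hsm : ∀ i j (z : ℂ) a b, Φ i j (star (z • a) * b) = (starRingEnd ℂ) z * Φ i j (star a * b) := by
    intro i j z a b
    rw [← hsymm j i b (z • a), mul_smul_comm, map_smul, smul_eq_mul, map_mul, hsymm]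
  let ip : (I →₀ W) → (I →₀ W) → ℂ := fun x y =>
    x.sum fun i a => y.sum fun j b => Φ i j (star (e a) * e b)
  have hip : ∀ x y, ip x y = x.sum fun i a => y.sum fun j b => Φ i j (star (e a) * e b) :=
    fun x y => rfl
  have hadd : ∀ x y z, ip (x + y) z = ip x z + ip y z := by
    intro x y z
    rw [hip, hip, hip]
    apply Finsupp.sum_add_index'
    · intro i; simp
    · intro i a b; simp [add_mul]
  have hsmul : ∀ x y (r : ℂ), ip (r • x) y = (starRingEnd ℂ) r * ip x y := by
    intro x y r
    rw [hip, hip, Finsupp.sum_smul_index']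
    · simp only [Finsupp.sum, Finset.mul_sum, map_smul, hsm]
    · intro i; simp
  have hconj : ∀ x y, (starRingEnd ℂ) (ip y x) = ip x y := by
    intro x y
    rw [hip, hip]
    simp only [Finsupp.sum, map_sum]
    rw [Finset.sum_comm]
    simp only [hsymm]
  let core : PreInnerProductSpace.Core ℂ (I →₀ W) :=
    { inner := ip
      conj_inner_symm := hconj
      re_inner_nonneg := by
        intro x
        exact hpos x.support (fun i => e (x i))
      add_left := hadd
      smul_left := hsmul }
  let i1 : SeminormedAddCommGroup (I →₀ W) := @InnerProductSpace.Core.toSeminormedAddCommGroup ℂ (I →₀ W) _ _ _ core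
  let i2 : InnerProductSpace ℂ (I →₀ W) := InnerProductSpace.ofCore core
  have hin : ∀ x y : I →₀ W, inner ℂ x y = ip x y := fun x y => rfl
  let m : B → W →ₗ[ℂ] W := fun a => e.symm.toLinearMap ∘ₗ LinearMap.mulLeft ℂ a ∘ₗ e.toLinearMap
  have hm : ∀ a w, e (m a w) = a * e w := by intro a w; simp [m]
  have hm' : ∀ a w, m a w = e.symm (a * e w) := by intro a w; simp [m]
  let ρ : B →ₐ[ℂ] Module.End ℂ (I →₀ W) :=
    { toFun := fun a => Finsupp.mapRange.linearMap (m a)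
      map_one' := by ext; simp [hm']
      map_mul' := by intro a b; ext; simp [hm', mul_assoc]
      map_zero' := by ext; simp [hm']
      map_add' := by intro a b; ext; simp [hm', add_mul]
      commutes' := by intro r; ext; simp [hm', Algebra.algebraMap_eq_smul_one, Finsupp.single_apply] }
  have hρ0 : ∀ a x, ρ a x = Finsupp.mapRange (m a) (map_zero _) x := fun a x => rfl
  have hρ : ∀ a x y, inner ℂ (ρ a x) y = inner ℂ x (ρ (star a) y) := by
    intro a x y
    rw [hin, hin, hip, hip, hρ0, hρ0, Finsupp.sum_mapRange_index]
    · refine Finsupp.sum_congr fun i _ => ?_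
      rw [Finsupp.sum_mapRange_index]
      · refine Finsupp.sum_congr fun j _ => ?_
        rw [hm, hm, star_mul, mul_assoc]
      · intro i; simp
    · intro i; simp
  obtain ⟨L, hL⟩ := extend_aux hb ρ hρ
  refine ⟨UniformSpace.Completion (I →₀ W), inferInstance, inferInstance, inferInstance, L,
    fun i => ((Finsupp.single i (e.symm 1) : I →₀ W) : UniformSpace.Completion (I →₀ W)), ?_⟩
  intro i j a
  rw [hL, UniformSpace.Completion.inner_coe, hin, hip, hρ0, Finsupp.mapRange_single,
    Finsupp.sum_single_index, Finsupp.sum_single_index, hm]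
  · simp
  · simp
  · simp

theorem burnside_aux {A : Type*} [Ring A] [Algebra ℂ A] {F : Type*} [AddCommGroup F] [Module ℂ F]
    [FiniteDimensional ℂ F] [Nontrivial F] (ρ : A →ₐ[ℂ] Module.End ℂ F)
    (hirr : ∀ p : Submodule ℂ F, (∀ a, ∀ x ∈ p, ρ a x ∈ p) → p = ⊥ ∨ p = ⊤) :
    Function.Surjective ρ := by
  classical
  let inst : Module A F := Module.compHom F ρ.toRingHom
  have hs : ∀ (a : A) (x : F), a • x = ρ a x := fun a x => rfl
  have hz : ∀ (z : ℂ) (x : F), (algebraMap ℂ A z) • x = z • x := by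
    intro z x; rw [hs]; simp
  let toC : Submodule A F → Submodule ℂ F := fun p =>
    { carrier := p
      add_mem' := p.add_mem
      zero_mem' := p.zero_mem
      smul_mem' := fun z x hx => by rw [← hz]; exact p.smul_mem _ hx }
  have hirr' : ∀ p : Submodule A F, p = ⊥ ∨ p = ⊤ := by
    intro p
    have hm : ∀ x, x ∈ toC p ↔ x ∈ p := fun x => Iff.rfl
    rcases hirr (toC p) (fun a x hx => p.smul_mem a hx) with h | h
    · left; ext x; rw [← hm, h]; simp
    · right; ext x; rw [← hm, h]; simp
  have simple : IsSimpleModule A F := { eq_bot_or_eq_top := hirr' }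
  have schur : ∀ f : Module.End A F, ∃ z : ℂ, ∀ x, f x = z • x := by
    intro f
    let f' : Module.End ℂ F :=
      { toFun := f, map_add' := f.map_add
        map_smul' := fun z x => by rw [← hz, f.map_smul, hz]; rfl }
    obtain ⟨z, hzz⟩ := Module.End.exists_eigenvalue f'
    obtain ⟨x, hx⟩ := hzz.exists_hasEigenvector
    have h := hirr (f'.eigenspace z) (by
      intro a y hy
      rw [Module.End.mem_eigenspace_iff] at hy ⊢
      change f (a • y) = z • (ρ a y)
      rw [f.map_smul, hs, ← map_smul, ← hy]; rfl)
    rcases h with h | h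
    · exact absurd h hzz
    · refine ⟨z, fun y => ?_⟩
      have : y ∈ f'.eigenspace z := by rw [h]; trivial
      exact Module.End.mem_eigenspace_iff.mp this
  intro g
  let g' : Module.End (Module.End A F) F :=
    { toFun := g, map_add' := g.map_add
      map_smul' := fun f x => by
        obtain ⟨z, h⟩ := schur f
        simp only [Module.End.smul_def, RingHom.id_apply, h, map_smul] }
  let b := Module.finBasis ℂ F
  obtain ⟨r, hr⟩ := jacobson_density g' (Finset.univ.image b)
  refine ⟨r, b.ext fun i => ?_⟩
  exact (hr (b i) (by simp)).symm

theorem quotient_aux {A : Type*} [Ring A] [StarRing A] [Algebra ℂ A] {K : Type*}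
    [NormedAddCommGroup K] [InnerProductSpace ℂ K] [CompleteSpace K]
    (π : A →⋆ₐ[ℂ] (K →L[ℂ] K)) (V₀ : Submodule ℂ K) (hfd : FiniteDimensional ℂ V₀)
    (hne : V₀ ≠ ⊥) (hinv : ∀ a, ∀ x ∈ V₀, π a x ∈ V₀) :
    ∃ (n : ℕ) (_ : 0 < n) (q : A →⋆ₐ[ℂ] Matrix (Fin n) (Fin n) ℂ), Function.Surjective q := by
  classical
  have hex : ∃ d : ℕ, ∃ V : Submodule ℂ K, FiniteDimensional ℂ V ∧ V ≠ ⊥ ∧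
      (∀ a, ∀ x ∈ V, π a x ∈ V) ∧ Module.finrank ℂ V = d := ⟨_, V₀, hfd, hne, hinv, rfl⟩
  obtain ⟨V, hV1, hV2, hV3, hV4⟩ := Nat.find_spec hex
  have hmin : ∀ V' : Submodule ℂ K, V' ≤ V → V' ≠ ⊥ → (∀ a, ∀ x ∈ V', π a x ∈ V') → V' = V := by
    intro V' hle h1 h2
    have : FiniteDimensional ℂ V' := Submodule.finiteDimensional_of_le hle
    apply Submodule.eq_of_le_of_finrank_le hle
    rw [hV4]
    exact Nat.find_min' hex ⟨V', this, h1, h2, rfl⟩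
  have : Nontrivial V := Submodule.nontrivial_iff_ne_bot.mpr hV2
  let ρ : A →ₐ[ℂ] Module.End ℂ V :=
    { toFun := fun a => (π a).toLinearMap.restrict (hV3 a)
      map_one' := by ext; simp
      map_mul' := by intro a b; ext; simp
      map_zero' := by ext; simp
      map_add' := by intro a b; ext; simp
      commutes' := by intro r; ext; simp [Algebra.algebraMap_eq_smul_one] }
  have hρ : ∀ a (x : V), ((ρ a x : V) : K) = π a x := fun a x => rfl
  have hsurj : Function.Surjective ρ := by
    apply burnside_aux
    intro p hp
    by_cases hb : p = ⊥
    · exact Or.inl hb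
    · right
      have := hmin (p.map V.subtype) (Submodule.map_subtype_le V p)
        (fun h => hb (Submodule.map_injective_of_injective V.injective_subtype
          (by rw [h, Submodule.map_bot])))
        (by
          rintro a _ ⟨x, hx, rfl⟩
          exact ⟨ρ a x, hp a x hx, rfl⟩)
      apply Submodule.map_injective_of_injective V.injective_subtype
      rw [this, Submodule.map_subtype_top]
  have hstar : ∀ a, ρ (star a) = star (ρ a) := by
    intro a
    rw [LinearMap.star_eq_adjoint, LinearMap.eq_adjoint_iff]
    intro x y
    rw [Submodule.coe_inner, Submodule.coe_inner, hρ, hρ, map_star,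
      ContinuousLinearMap.star_eq_adjoint, ContinuousLinearMap.adjoint_inner_left]
  let ρ' : A →⋆ₐ[ℂ] (V →ₗ[ℂ] V) := { ρ with map_star' := hstar }
  let b := stdOrthonormalBasis ℂ V
  let q := ((LinearMap.toMatrixOrthonormal b : (V →ₗ[ℂ] V) ≃⋆ₐ[ℂ] _) : (V →ₗ[ℂ] V) →⋆ₐ[ℂ] Matrix (Fin (Module.finrank ℂ V)) (Fin (Module.finrank ℂ V)) ℂ).comp ρ'
  refine ⟨Module.finrank ℂ V, Module.finrank_pos, q, ?_⟩
  have : (q : A → _) = (LinearMap.toMatrixOrthonormal b) ∘ ρ := rfl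
  rw [this]
  exact (LinearMap.toMatrixOrthonormal b).surjective.comp hsurj

open scoped TensorProduct in
theorem central_aux {A : Type*} [Ring A] [StarRing A] [Algebra ℂ A] {K K' : Type}
    [NormedAddCommGroup K] [InnerProductSpace ℂ K] [CompleteSpace K]
    [NormedAddCommGroup K'] [InnerProductSpace ℂ K'] [CompleteSpace K']
    (π : A →⋆ₐ[ℂ] (K →L[ℂ] K)) (π' : Aᵐᵒᵖ →⋆ₐ[ℂ] (K' →L[ℂ] K'))
    (η : UniformSpace.Completion (K ⊗[ℂ] K')) (hη : η ≠ 0)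
    (hcen : ∀ (a : A) (x : K) (v : K'),
      inner ℂ ((π a x ⊗ₜ[ℂ] v : K ⊗[ℂ] K') : UniformSpace.Completion (K ⊗[ℂ] K')) η =
      inner ℂ ((x ⊗ₜ[ℂ] π' (op a) v : K ⊗[ℂ] K') : UniformSpace.Completion (K ⊗[ℂ] K')) η) :
    ∃ V₀ : Submodule ℂ K, FiniteDimensional ℂ V₀ ∧ V₀ ≠ ⊥ ∧ ∀ a, ∀ x ∈ V₀, π a x ∈ V₀ := by
  let ι : K ⊗[ℂ] K' →L[ℂ] UniformSpace.Completion (K ⊗[ℂ] K') := UniformSpace.Completion.toComplL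
  have hι : ∀ z, ι z = (z : UniformSpace.Completion (K ⊗[ℂ] K')) := fun z => rfl
  let C : K →L[ℂ] K' →L[ℂ] UniformSpace.Completion (K ⊗[ℂ] K') :=
    (ContinuousLinearMap.compL ℂ K' _ _ ι) ∘L (TensorProduct.mkL ℂ K K')
  have hC : ∀ x v, C x v = ((x ⊗ₜ[ℂ] v : K ⊗[ℂ] K') : UniformSpace.Completion (K ⊗[ℂ] K')) :=
    fun x v => rfl
  let J : K →L⋆[ℂ] (UniformSpace.Completion (K ⊗[ℂ] K') →L[ℂ] K') :=
    (ContinuousLinearMap.adjoint.toContinuousLinearEquiv.toContinuousLinearMap).comp C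
  let J' : K' →L⋆[ℂ] (UniformSpace.Completion (K ⊗[ℂ] K') →L[ℂ] K) :=
    (ContinuousLinearMap.adjoint.toContinuousLinearEquiv.toContinuousLinearMap).comp C.flip
  let D := J.flip
  let D' := J'.flip
  have hD : ∀ ζ x v, inner ℂ v (D ζ x) = inner ℂ (C x v) ζ := by
    intro ζ x v
    exact ContinuousLinearMap.adjoint_inner_right (C x) v ζ
  have hD' : ∀ ζ x v, inner ℂ x (D' ζ v) = inner ℂ (C x v) ζ := by
    intro ζ x v
    exact ContinuousLinearMap.adjoint_inner_right (C.flip v) x ζ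
  have hcomp : ∀ ζ, IsCompactOperator (D ζ) := by
    have hcl : IsClosed {ζ | IsCompactOperator (D ζ)} :=
      (isClosed_setOfPred_isCompactOperator (σ₁₂ := starRingEnd ℂ) (M₁ := K) (M₂ := K')).preimage
        D.continuous
    intro ζ
    induction ζ using UniformSpace.Completion.induction_on with
    | hp => exact hcl
    | ih z =>
      induction z using TensorProduct.induction_on with
      | zero =>
        rw [UniformSpace.Completion.coe_zero, map_zero]
        exact isCompactOperator_zero
      | add z w hz hw =>
        rw [UniformSpace.Completion.coe_add, map_add]
        exact hz.add hw
      | tmul x u =>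
        have h1 : ∀ y, D (C x u) y = (ContinuousLinearMap.toSpanSingleton ℂ u) (inner ℂ y x) := by
          intro y
          refine ext_inner_left ℂ fun v => ?_
          rw [hD, hC, hC, UniformSpace.Completion.inner_coe, TensorProduct.inner_tmul,
            ContinuousLinearMap.toSpanSingleton_apply, inner_smul_right]
        have h2 : (D (C x u) : K → K') =
            (ContinuousLinearMap.toSpanSingleton ℂ u) ∘ ((innerSL ℂ).flip x : K →L⋆[ℂ] ℂ) := by
          funext y; exact h1 y
        change IsCompactOperator (D (C x u))
        rw [h2]
        apply IsCompactOperator.clm_comp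
        exact isCompactOperator_of_locallyCompactSpace_dom _
  let S : K →L[ℂ] K := (D' η).comp (D η)
  have hS : ∀ x, S x = D' η (D η x) := fun x => rfl
  have hSin : ∀ x y, inner ℂ x (S y) = inner ℂ (D η y) (D η x) := by
    intro x y; rw [hS, hD', hD]
  have hScomp : IsCompactOperator S := (hcomp η).clm_comp (D' η)
  have hSsymm : S.IsSymmetric := by
    intro x y
    change inner ℂ (S x) y = inner ℂ x (S y)
    rw [← inner_conj_symm, hSin, hSin, inner_conj_symm]
  have hSne : S ≠ 0 := by
    intro h0
    have hDx : ∀ x, D η x = 0 := by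
      intro x
      have := hSin x x
      rw [h0] at this
      simpa using this.symm
    apply hη
    have : ∀ ζ, inner ℂ ζ η = 0 := by
      intro ζ
      induction ζ using UniformSpace.Completion.induction_on with
      | hp => exact isClosed_eq (by fun_prop) (by fun_prop)
      | ih z =>
        induction z using TensorProduct.induction_on with
        | zero => rw [UniformSpace.Completion.coe_zero, inner_zero_left]
        | add z w hz hw => rw [UniformSpace.Completion.coe_add, inner_add_left, hz, hw, add_zero]
        | tmul x u => rw [← hC, ← hD, hDx, inner_zero_right]
    exact inner_self_eq_zero.mp (this η)
  have hD1 : ∀ a x, D η (π a x) = π' (op (star a)) (D η x) := by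
    intro a x
    refine ext_inner_left ℂ fun v => ?_
    rw [hD, hC, hcen, ← hC, ← hD, op_star, map_star, ContinuousLinearMap.star_eq_adjoint,
      ContinuousLinearMap.adjoint_inner_right]
  have hD2 : ∀ a v, D' η (π' (op (star a)) v) = π a (D' η v) := by
    intro a v
    refine ext_inner_left ℂ fun x => ?_
    rw [hD', hC, ← hcen, ← hC, ← hD', map_star, ContinuousLinearMap.star_eq_adjoint,
      ContinuousLinearMap.adjoint_inner_left]
  have hcomm : ∀ a x, S (π a x) = π a (S x) := by
    intro a x; rw [hS, hD1, hD2, hS]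
  have hex : ∃ μ, Module.End.HasEigenvalue (S : Module.End ℂ K) μ ∧ μ ≠ 0 := by
    by_contra! h
    exact hSne ((ContinuousLinearMap.eq_zero_of_forall_hasEigenvalue_eq_zero hScomp hSsymm).mp h)
  obtain ⟨μ, hμ, hμ0⟩ := hex
  refine ⟨Module.End.eigenspace (S : Module.End ℂ K) μ,
    ContinuousLinearMap.finite_dimensional_eigenspace hScomp μ hμ0, hμ, ?_⟩
  intro a x hx
  rw [Module.End.mem_eigenspace_iff] at hx ⊢
  change S (π a x) = _
  change S x = _ at hx
  rw [hcomm, hx, map_smul]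

theorem small_aux (A : Type*) [MetricSpace A] [TopologicalSpace.SeparableSpace A] :
    Small.{0} A := by
  cases isEmpty_or_nonempty A with
  | inl h => exact small_of_injective (β := ℕ) (f := fun a => h.elim a) (fun a => h.elim a)
  | inr h =>
    refine small_of_injective (β := ℕ → ℝ)
      (f := fun a n => dist a (TopologicalSpace.denseSeq A n)) ?_
    intro a b hab
    have hd := TopologicalSpace.denseRange_denseSeq A
    have : (fun z => dist a z) = fun z => dist b z :=
      hd.equalizer (by fun_prop) (by fun_prop) hab
    have := congrFun this b
    simpa using this

theorem cp_symm {B : Type*} [Ring B] [StarRing B] [Algebra ℂ B] {k : ℕ}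
    {φ : B →ₗ[ℂ] Matrix (Fin k) (Fin k) ℂ} (h : IsCompletelyPositive φ) (a b : B) :
    (φ (star a * b)).conjTranspose = φ (star b * a) := by
  have h0 : ∀ c, (φ (star c * c)).conjTranspose = φ (star c * c) := by
    intro c
    have := (h 1 ![c] ![1]).isHermitian
    simpa [Matrix.IsHermitian] using this
  have h1 := (h 2 ![a, b] ![1, 1]).isHermitian
  have h2 := (h 2 ![a, b] ![1, Complex.I • 1]).isHermitian
  simp only [Matrix.IsHermitian, Fin.sum_univ_two, Matrix.cons_val_zero, Matrix.cons_val_one,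
    Matrix.conjTranspose_add, Matrix.conjTranspose_one, one_mul, mul_one, h0,
    Matrix.conjTranspose_smul, Matrix.smul_mul, Matrix.mul_smul, smul_smul] at h1 h2
  simp only [Complex.star_def, map_mul, map_neg, Complex.conj_I] at h2
  set X := φ (star a * b)
  set Y := φ (star b * a)
  ext i j
  have f1 := congrFun (congrFun h1 i) j
  have f2 := congrFun (congrFun h2 i) j
  simp only [Matrix.add_apply, Matrix.smul_apply, smul_eq_mul] at f1 f2
  have hI := Complex.I_mul_I
  linear_combination (1/2 : ℂ) * f1 + (1/2 : ℂ) * Complex.I * f2 + (1/2 : ℂ) * (Xᴴ i j - Yᴴ i j + X i j - Y i j) * hI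

theorem cp_pos {B : Type*} [Ring B] [StarRing B] [Algebra ℂ B] {k : ℕ} (hk : 0 < k)
    {φ : B →ₗ[ℂ] Matrix (Fin k) (Fin k) ℂ} (h : IsCompletelyPositive φ) {I : Type*}
    (s : Finset I) (a : I → B) (u : I → Fin k → ℂ) :
    0 ≤ ∑ p ∈ s, ∑ q ∈ s, star (u p) ⬝ᵥ (φ (star (a p) * a q) *ᵥ u q) := by
  have key := h s.card (fun i => a (s.equivFin.symm i))
    (fun i => Matrix.of fun r _ => u (s.equivFin.symm i) r)
  have h0 := key.diag_nonneg (i := (⟨0, hk⟩ : Fin k))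
  have : ∑ p ∈ s, ∑ q ∈ s, star (u p) ⬝ᵥ (φ (star (a p) * a q) *ᵥ u q) =
      ∑ i : Fin s.card, ∑ j : Fin s.card, star (u (s.equivFin.symm i)) ⬝ᵥ
        (φ (star (a (s.equivFin.symm i)) * a (s.equivFin.symm j)) *ᵥ u (s.equivFin.symm j)) := by
    rw [← Finset.sum_coe_sort s, ← s.equivFin.symm.sum_comp]
    refine Finset.sum_congr rfl fun i _ => ?_
    rw [← Finset.sum_coe_sort s, ← s.equivFin.symm.sum_comp]
  rw [this]
  convert h0 using 1
  simp only [Matrix.sum_apply]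
  refine Finset.sum_congr rfl fun i _ => Finset.sum_congr rfl fun j _ => ?_
  rw [Matrix.mul_assoc, Matrix.mul_apply]
  simp [dotProduct, Matrix.mul_apply, Matrix.mulVec]

theorem stine_aux {B : Type*} [Ring B] [StarRing B] [Algebra ℂ B]
    (hb : ∀ a : B, ∃ (c : B) (N : ℕ), star a * a + star c * c = (N : B))
    {W : Type} [AddCommGroup W] [Module ℂ W] (e : W ≃ₗ[ℂ] B)
    (k : ℕ → ℕ) (φ : ∀ n : ℕ, B →ₗ[ℂ] Matrix (Fin (k n)) (Fin (k n)) ℂ)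
    (hk : ∀ n, 0 < k n) (hcp : ∀ n, IsCompletelyPositive (φ n)) :
    ∃ (K : Type) (_ : NormedAddCommGroup K) (_ : InnerProductSpace ℂ K) (_ : CompleteSpace K)
      (π : B →⋆ₐ[ℂ] (K →L[ℂ] K)) (v : ∀ n, Fin (k n) → K),
      ∀ n i j a, inner ℂ (v n i) (π a (v n j)) = φ n a i j := by
  classical
  let u : ∀ n, (Σ n, Fin (k n)) → Fin (k n) → ℂ := fun n p r => if p = ⟨n, r⟩ then 1 else 0
  have hu0 : ∀ n p, p.1 ≠ n → u n p = 0 := by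
    intro n p hp
    funext r
    have : p ≠ ⟨n, r⟩ := by rintro rfl; exact hp rfl
    simp [u, this]
  have hu1 : ∀ n i, u n ⟨n, i⟩ = Pi.single i 1 := by
    intro n i
    funext r
    by_cases h : i = r
    · subst h; simp [u]
    · have : (⟨n, i⟩ : Σ n, Fin (k n)) ≠ ⟨n, r⟩ := by
        intro h'; apply h; simpa using h'
      simp [u, this, Ne.symm h]
  let Φ : (Σ n, Fin (k n)) → (Σ n, Fin (k n)) → B →ₗ[ℂ] ℂ := fun p q =>
    { toFun := fun a => star (u p.1 p) ⬝ᵥ (φ p.1 a *ᵥ u p.1 q)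
      map_add' := by intro a b; rw [map_add, Matrix.add_mulVec, dotProduct_add]
      map_smul' := by intro r a; rw [map_smul, Matrix.smul_mulVec, dotProduct_smul]; rfl }
  have hΦ : ∀ p q a, Φ p q a = star (u p.1 p) ⬝ᵥ (φ p.1 a *ᵥ u p.1 q) := fun p q a => rfl
  have hΦ0 : ∀ p q a, p.1 ≠ q.1 → Φ p q a = 0 := by
    intro p q a h
    rw [hΦ, hu0 p.1 q h.symm]; simp
  obtain ⟨K, i1, i2, i3, π, v, hv⟩ := gns_aux hb e Φ (by
    intro p q a b
    by_cases h : p.1 = q.1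
    · obtain ⟨n, i⟩ := p
      obtain ⟨m, j⟩ := q
      simp only at h
      subst h
      rw [hΦ, hΦ]
      simp only [hu1, ← cp_symm (hcp n) a b]
      simp
    · rw [hΦ0 _ _ _ h, hΦ0 _ _ _ (Ne.symm h), map_zero]) (by
    intro s a
    have : ∑ p ∈ s, ∑ q ∈ s, Φ p q (star (a p) * a q) = ∑ n ∈ s.image Sigma.fst,
        ∑ p ∈ s, ∑ q ∈ s, star (u n p) ⬝ᵥ (φ n (star (a p) * a q) *ᵥ u n q) := by
      symm
      rw [Finset.sum_comm]
      refine Finset.sum_congr rfl fun p hp => ?_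
      rw [Finset.sum_comm]
      refine Finset.sum_congr rfl fun q hq => ?_
      rw [Finset.sum_eq_single p.1, hΦ]
      · intro n _ hn
        rw [hu0 n p hn.symm]; simp
      · intro h; exact absurd (Finset.mem_image_of_mem _ hp) h
    rw [this]
    have h2 : (0:ℂ) ≤ ∑ n ∈ s.image Sigma.fst,
        ∑ p ∈ s, ∑ q ∈ s, star (u n p) ⬝ᵥ (φ n (star (a p) * a q) *ᵥ u n q) :=
      Finset.sum_nonneg fun n _ => cp_pos (hk n) (hcp n) s a (u n)
    exact (Complex.le_def.mp h2).1)
  refine ⟨K, i1, i2, i3, π, fun n i => v ⟨n, i⟩, ?_⟩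
  intro n i j a
  rw [hv, hΦ]
  simp [hu1]

theorem cp_op {B : Type*} [Ring B] [StarRing B] [Algebra ℂ B] {k : ℕ}
    {φ : B →ₗ[ℂ] Matrix (Fin k) (Fin k) ℂ} (h : IsCompletelyPositive φ) :
    ∃ ψ : Bᵐᵒᵖ →ₗ[ℂ] Matrix (Fin k) (Fin k) ℂ, IsCompletelyPositive ψ ∧
      ∀ a, ψ (op a) = (φ a).transpose := by
  refine ⟨{ toFun := fun a => (φ a.unop).transpose, map_add' := ?_, map_smul' := ?_ }, ?_, ?_⟩
  · intro a b; simp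
  · intro a b; simp
  · intro m a v
    have := (h m (fun i => star (a i).unop) (fun i => (v i).map star)).transpose
    simp only [Matrix.transpose_sum] at this
    rw [Finset.sum_comm] at this
    refine Eq.mp (congrArg Matrix.PosSemidef ?_) this
    refine Finset.sum_congr rfl fun i _ => ?_
    refine Finset.sum_congr rfl fun j _ => ?_
    simp only [LinearMap.coe_mk, AddHom.coe_mk, unop_mul, unop_star, star_star,
      Matrix.transpose_mul, Matrix.mul_assoc]
    congr 1
    congr 1
    ext r s
    simp
  · intro a; rfl

open scoped TensorProduct in
/-- the commuting actions on the completed tensor product -/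
theorem bimod_aux {B B' : Type*} [Ring B] [StarRing B] [Algebra ℂ B]
    [Ring B'] [StarRing B'] [Algebra ℂ B']
    (hb : ∀ a : B, ∃ (c : B) (N : ℕ), star a * a + star c * c = (N : B))
    (hb' : ∀ a : B', ∃ (c : B') (N : ℕ), star a * a + star c * c = (N : B'))
    {K K' : Type}
    [NormedAddCommGroup K] [InnerProductSpace ℂ K] [CompleteSpace K]
    [NormedAddCommGroup K'] [InnerProductSpace ℂ K'] [CompleteSpace K']
    (π : B →⋆ₐ[ℂ] (K →L[ℂ] K)) (π' : B' →⋆ₐ[ℂ] (K' →L[ℂ] K')) :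
    ∃ (L : B →⋆ₐ[ℂ] (UniformSpace.Completion (K ⊗[ℂ] K') →L[ℂ] UniformSpace.Completion (K ⊗[ℂ] K')))
      (R : B' →⋆ₐ[ℂ] (UniformSpace.Completion (K ⊗[ℂ] K') →L[ℂ] UniformSpace.Completion (K ⊗[ℂ] K'))),
      (∀ a x v, L a ((x ⊗ₜ[ℂ] v : K ⊗[ℂ] K') : UniformSpace.Completion (K ⊗[ℂ] K')) =
        ((π a x ⊗ₜ[ℂ] v : K ⊗[ℂ] K') : UniformSpace.Completion (K ⊗[ℂ] K'))) ∧
      (∀ b x v, R b ((x ⊗ₜ[ℂ] v : K ⊗[ℂ] K') : UniformSpace.Completion (K ⊗[ℂ] K')) =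
        ((x ⊗ₜ[ℂ] π' b v : K ⊗[ℂ] K') : UniformSpace.Completion (K ⊗[ℂ] K'))) ∧
      ∀ a b, Commute (L a) (R b) := by
  have adj : ∀ a (x y : K), inner ℂ (π a x) y = inner ℂ x (π (star a) y) := by
    intro a x y
    rw [map_star, ContinuousLinearMap.star_eq_adjoint, ContinuousLinearMap.adjoint_inner_right]
  have adj' : ∀ a (x y : K'), inner ℂ (π' a x) y = inner ℂ x (π' (star a) y) := by
    intro a x y
    rw [map_star, ContinuousLinearMap.star_eq_adjoint, ContinuousLinearMap.adjoint_inner_right]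
  let ρ : B →ₐ[ℂ] Module.End ℂ (K ⊗[ℂ] K') :=
    AlgHom.ofLinearMap
      { toFun := fun a => LinearMap.rTensor K' (π a : K →ₗ[ℂ] K)
        map_add' := by
          intro a b; apply TensorProduct.ext'; intro x y; simp [TensorProduct.add_tmul]
        map_smul' := by
          intro a b; apply TensorProduct.ext'; intro x y; simp [TensorProduct.smul_tmul'] }
      (by apply TensorProduct.ext'; intro x y; simp)
      (by intro a b; apply TensorProduct.ext'; intro x y; simp)
  have hρ0 : ∀ a x v, ρ a (x ⊗ₜ[ℂ] v) = π a x ⊗ₜ[ℂ] v := fun a x v => rfl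
  let ρ' : B' →ₐ[ℂ] Module.End ℂ (K ⊗[ℂ] K') :=
    AlgHom.ofLinearMap
      { toFun := fun a => LinearMap.lTensor K (π' a : K' →ₗ[ℂ] K')
        map_add' := by
          intro a b; apply TensorProduct.ext'; intro x y; simp [TensorProduct.tmul_add]
        map_smul' := by
          intro a b; apply TensorProduct.ext'; intro x y; simp }
      (by apply TensorProduct.ext'; intro x y; simp)
      (by intro a b; apply TensorProduct.ext'; intro x y; simp)
  have hρ0' : ∀ a x v, ρ' a (x ⊗ₜ[ℂ] v) = x ⊗ₜ[ℂ] π' a v := fun a x v => rfl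
  have hρ : ∀ a x y, inner ℂ (ρ a x) y = inner ℂ x (ρ (star a) y) := by
    intro a x y
    induction x using TensorProduct.induction_on with
    | zero => simp
    | add x1 x2 h1 h2 => rw [map_add, inner_add_left, inner_add_left, h1, h2]
    | tmul p q =>
      induction y using TensorProduct.induction_on with
      | zero => simp
      | add x1 x2 h1 h2 => rw [map_add, inner_add_right, inner_add_right, h1, h2]
      | tmul r s => rw [hρ0, hρ0, TensorProduct.inner_tmul, TensorProduct.inner_tmul, adj]
  have hρ' : ∀ a x y, inner ℂ (ρ' a x) y = inner ℂ x (ρ' (star a) y) := by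
    intro a x y
    induction x using TensorProduct.induction_on with
    | zero => simp
    | add x1 x2 h1 h2 => rw [map_add, inner_add_left, inner_add_left, h1, h2]
    | tmul p q =>
      induction y using TensorProduct.induction_on with
      | zero => simp
      | add x1 x2 h1 h2 => rw [map_add, inner_add_right, inner_add_right, h1, h2]
      | tmul r s => rw [hρ0', hρ0', TensorProduct.inner_tmul, TensorProduct.inner_tmul, adj']
  obtain ⟨L, hL⟩ := extend_aux hb ρ hρ
  obtain ⟨R, hR⟩ := extend_aux hb' ρ' hρ'
  refine ⟨L, R, fun a x v => by rw [hL, hρ0], fun a x v => by rw [hR, hρ0'], fun a b => ?_⟩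
  show L a * R b = R b * L a
  ext z
  induction z using UniformSpace.Completion.induction_on with
  | hp => exact isClosed_eq (by fun_prop) (by fun_prop)
  | ih z =>
    show L a (R b z) = R b (L a z)
    rw [hL, hR, hL, hR]
    congr 1
    induction z using TensorProduct.induction_on with
    | zero => simp
    | add x1 x2 h1 h2 => rw [map_add, map_add, map_add, map_add, h1, h2]
    | tmul p q => rw [hρ0, hρ0', hρ0, hρ0']

theorem trace_aux {k : ℕ} (hk : 0 < k) (X : Matrix (Fin k) (Fin k) ℂ) :
    ‖X.trace‖ / k ≤ Real.sqrt ((X.conjTranspose * X).trace.re / k) := by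
  have hk' : (0 : ℝ) < k := by exact_mod_cast hk
  apply Real.le_sqrt_of_sq_le
  have h1 : (X.conjTranspose * X).trace.re = ∑ j, ∑ i, ‖X i j‖ ^ 2 := by
    simp only [Matrix.trace, Matrix.diag, Matrix.mul_apply, Matrix.conjTranspose_apply,
      Complex.re_sum]
    refine Finset.sum_congr rfl fun j _ => Finset.sum_congr rfl fun i _ => ?_
    rw [Complex.star_def, ← Complex.normSq_eq_conj_mul_self, Complex.ofReal_re,
      Complex.normSq_eq_norm_sq]
  have h2 : ‖X.trace‖ ^ 2 ≤ k * ∑ j, ‖X j j‖ ^ 2 := by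
    have a1 : ‖X.trace‖ ≤ ∑ j, ‖X j j‖ := norm_sum_le _ _
    have a2 := sq_sum_le_card_mul_sum_sq (s := (Finset.univ : Finset (Fin k)))
      (f := fun j => ‖X j j‖)
    simp only [Finset.card_univ, Fintype.card_fin] at a2
    exact (pow_le_pow_left₀ (norm_nonneg _) a1 2).trans a2
  have h3 : ∑ j, ‖X j j‖ ^ 2 ≤ ∑ j, ∑ i, ‖X i j‖ ^ 2 :=
    Finset.sum_le_sum fun j _ =>
      Finset.single_le_sum (f := fun i => ‖X i j‖ ^ 2) (fun i _ => by positivity)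
        (Finset.mem_univ j)
  rw [h1, div_pow, div_le_div_iff₀ (by positivity) hk']
  nlinarith [mul_le_mul_of_nonneg_left h3 hk'.le]

open scoped TensorProduct in
theorem norm_aux {A : Type*} [Ring A] [StarRing A] [Algebra ℂ A] {K K' : Type}
    [NormedAddCommGroup K] [InnerProductSpace ℂ K] [CompleteSpace K]
    [NormedAddCommGroup K'] [InnerProductSpace ℂ K'] [CompleteSpace K']
    (π : A →⋆ₐ[ℂ] (K →L[ℂ] K)) (π' : Aᵐᵒᵖ →⋆ₐ[ℂ] (K' →L[ℂ] K'))
    {k : ℕ} (hk : 0 < k) (φ : A →ₗ[ℂ] Matrix (Fin k) (Fin k) ℂ) (h1 : φ 1 = 1)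
    (v : Fin k → K) (v' : Fin k → K')
    (hv : ∀ i j a, inner ℂ (v i) (π a (v j)) = φ a i j)
    (hv' : ∀ i j a, inner ℂ (v' i) (π' (op a) (v' j)) = φ a j i) (a : A) :
    ‖∑ i, v i ⊗ₜ[ℂ] v' i‖ ^ 2 = k ∧
    ‖∑ i, (π a (v i) ⊗ₜ[ℂ] v' i - v i ⊗ₜ[ℂ] π' (op a) (v' i))‖ ^ 2 ≤
      k * (Real.sqrt ((((φ (star a * a) - φ (star a) * φ a).conjTranspose *
        (φ (star a * a) - φ (star a) * φ a)).trace).re / k) +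
       Real.sqrt ((((φ (a * star a) - φ a * φ (star a)).conjTranspose *
        (φ (a * star a) - φ a * φ (star a))).trace).re / k)) := by
  have hk' : (0 : ℝ) < k := by exact_mod_cast hk
  have adj : ∀ a (x y : K), inner ℂ (π a x) y = inner ℂ x (π (star a) y) := by
    intro a x y
    rw [map_star, ContinuousLinearMap.star_eq_adjoint, ContinuousLinearMap.adjoint_inner_right]
  have adj' : ∀ a (x y : K'), inner ℂ (π' a x) y = inner ℂ x (π' (star a) y) := by
    intro a x y
    rw [map_star, ContinuousLinearMap.star_eq_adjoint, ContinuousLinearMap.adjoint_inner_right]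
  have w1 : ∀ i j, inner ℂ (v i) (v j) = (1 : Matrix (Fin k) (Fin k) ℂ) i j := by
    intro i j
    have := hv i j 1
    simpa [h1] using this
  have w1' : ∀ i j, inner ℂ (v' i) (v' j) = (1 : Matrix (Fin k) (Fin k) ℂ) j i := by
    intro i j
    have := hv' i j 1
    simpa [h1] using this
  have w2 : ∀ i j, inner ℂ (π a (v i)) (π a (v j)) = φ (star a * a) i j := by
    intro i j
    rw [adj, ← hv, map_mul]; rfl
  have w2' : ∀ i j, inner ℂ (π' (op a) (v' i)) (π' (op a) (v' j)) = φ (a * star a) j i := by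
    intro i j
    rw [adj', ← hv', op_mul, map_mul]; rfl
  have w3 : ∀ i j, inner ℂ (π a (v i)) (v j) = φ (star a) i j := by
    intro i j
    rw [adj, ← hv]
  have w3' : ∀ i j, inner ℂ (π' (op a) (v' i)) (v' j) = φ (star a) j i := by
    intro i j
    rw [adj', ← hv']; rfl
  constructor
  · have : inner ℂ (∑ i, v i ⊗ₜ[ℂ] v' i) (∑ i, v i ⊗ₜ[ℂ] v' i) = (k : ℂ) := by
      simp only [sum_inner, inner_sum, TensorProduct.inner_tmul, w1, w1']
      simp [Matrix.one_apply]
    rw [← inner_self_eq_norm_sq (𝕜 := ℂ), this]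
    simp
  · set X := φ (star a * a) - φ (star a) * φ a with hX
    set Y := φ (a * star a) - φ a * φ (star a) with hY
    have : inner ℂ (∑ i, (π a (v i) ⊗ₜ[ℂ] v' i - v i ⊗ₜ[ℂ] π' (op a) (v' i)))
        (∑ i, (π a (v i) ⊗ₜ[ℂ] v' i - v i ⊗ₜ[ℂ] π' (op a) (v' i))) = X.trace + Y.trace := by
      have e1 : ∀ M N : Matrix (Fin k) (Fin k) ℂ, (M * N).trace = ∑ j, ∑ i, M i j * N j i := by
        intro M N
        rw [Finset.sum_comm]
        simp [Matrix.trace, Matrix.mul_apply]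
      simp only [sum_inner, inner_sum, inner_sub_left, inner_sub_right,
        TensorProduct.inner_tmul, w1, w1', w2, w2', w3, w3', hv, hv', Finset.sum_sub_distrib]
      rw [← e1, ← e1, ← e1, ← e1, hX, hY, Matrix.trace_sub, Matrix.trace_sub, mul_one, one_mul]
      ring
    rw [← inner_self_eq_norm_sq (𝕜 := ℂ), this]
    have tX := trace_aux hk X
    have tY := trace_aux hk Y
    rw [div_le_iff₀ hk'] at tX tY
    have b1 := Complex.re_le_norm X.trace
    have b2 := Complex.re_le_norm Y.trace
    have : RCLike.re (X.trace + Y.trace) = X.trace.re + Y.trace.re := by simp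
    rw [this]
    nlinarith

open scoped TensorProduct in
theorem forward_aux {A : Type*} [NormedRing A] [StarRing A] [CStarRing A] [NormedAlgebra ℂ A]
    [CompleteSpace A] [TopologicalSpace.SeparableSpace A]
    (hT : PropertyT A) (τ : A →ₗ[ℂ] ℂ) (hτ : IsAmenableTrace τ) :
      ∃ (n : ℕ) (_ : 0 < n) (q : A →⋆ₐ[ℂ] Matrix (Fin n) (Fin n) ℂ),
        Function.Surjective q := by
  obtain ⟨-, k, φ, hφ, hmul, -⟩ := hτ
  have hb : ∀ a : A, ∃ (c : A) (N : ℕ), star a * a + star c * c = (N : A) := bdd_aux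
  have hb' : ∀ a : Aᵐᵒᵖ, ∃ (c : Aᵐᵒᵖ) (N : ℕ), star a * a + star c * c = (N : Aᵐᵒᵖ) := by
    intro a
    obtain ⟨c, N, h⟩ := hb (star a.unop)
    refine ⟨op (star c), N, ?_⟩
    apply MulOpposite.unop_injective
    simpa using h
  haveI : Small.{0} A := small_aux A
  let e : Shrink.{0} A ≃ₗ[ℂ] A := Shrink.linearEquiv.{0} ℂ A
  have hk : ∀ n, 0 < k n := fun n => (hφ n).1
  have h1 : ∀ n, φ n 1 = 1 := fun n => (hφ n).2.1
  have hcp : ∀ n, IsCompletelyPositive (φ n) := fun n => (hφ n).2.2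
  choose ψ hψ hψφ using fun n => cp_op (hcp n)
  obtain ⟨K, _, _, _, π, v, hv⟩ := stine_aux hb e k φ hk hcp
  obtain ⟨K', _, _, _, π', v', hv'⟩ :=
    stine_aux hb' (e.trans (MulOpposite.opLinearEquiv ℂ)) k ψ hk hψ
  obtain ⟨L, R, hL, hR, hcomm⟩ := bimod_aux hb hb' π π'
  have hest := fun n a => norm_aux π π' (hk n) (φ n) (h1 n) (v n) (v' n) (hv n)
    (fun i j a => by rw [hv' n, hψφ]; rfl) a
  let ζ : ∀ n, K ⊗[ℂ] K' := fun n => ∑ i, v n i ⊗ₜ[ℂ] v' n i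
  have hζ : ∀ n, ‖ζ n‖ = Real.sqrt (k n) := by
    intro n
    rw [← (hest n 1).1, Real.sqrt_sq (norm_nonneg _)]
  have hs : ∀ n, 0 < Real.sqrt (k n) := fun n => Real.sqrt_pos.2 (by exact_mod_cast hk n)
  have hdiff : ∀ n a, L a (ζ n : UniformSpace.Completion (K ⊗[ℂ] K')) -
      R (op a) (ζ n : UniformSpace.Completion (K ⊗[ℂ] K')) =
      ((∑ i, (π a (v n i) ⊗ₜ[ℂ] v' n i - v n i ⊗ₜ[ℂ] π' (op a) (v' n i)) : K ⊗[ℂ] K') :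
        UniformSpace.Completion (K ⊗[ℂ] K')) := by
    intro n a
    let ι : K ⊗[ℂ] K' →L[ℂ] UniformSpace.Completion (K ⊗[ℂ] K') := UniformSpace.Completion.toComplL
    have hι : ∀ z : K ⊗[ℂ] K', (z : UniformSpace.Completion (K ⊗[ℂ] K')) = ι z := fun z => rfl
    simp only [hι] at hL hR ⊢
    simp only [ζ, map_sum, map_sub, hL, hR, Finset.sum_sub_distrib]
  obtain ⟨η, hη, hc⟩ := hT (UniformSpace.Completion (K ⊗[ℂ] K')) L R hcomm
    ⟨fun n => (((Real.sqrt (k n))⁻¹ : ℝ) : ℂ) • (ζ n : UniformSpace.Completion (K ⊗[ℂ] K')), by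
      intro n
      rw [norm_smul, UniformSpace.Completion.norm_coe, hζ, Complex.norm_real, Real.norm_eq_abs,
        abs_of_pos (inv_pos.2 (hs n)), inv_mul_cancel₀ (hs n).ne'], by
      intro a
      have hlim := (hmul (star a) a).add (hmul a (star a))
      rw [add_zero] at hlim
      have hlim2 := hlim.sqrt
      rw [Real.sqrt_zero] at hlim2
      refine squeeze_zero (fun n => norm_nonneg _) (fun n => ?_) hlim2
      apply Real.le_sqrt_of_sq_le
      rw [map_smul, map_smul, ← smul_sub, hdiff, norm_smul, UniformSpace.Completion.norm_coe,
        Complex.norm_real, Real.norm_eq_abs, abs_of_pos (inv_pos.2 (hs n)), mul_pow, inv_pow,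
        Real.sq_sqrt (Nat.cast_nonneg _), inv_mul_le_iff₀ (by exact_mod_cast hk n)]
      exact (hest n a).2⟩
  obtain ⟨V₀, hf, hne, hinv⟩ := central_aux π π' η hη (by
    intro a x u
    rw [← hL, ← hR, ← ContinuousLinearMap.adjoint_inner_right,
      ← ContinuousLinearMap.adjoint_inner_right, ← ContinuousLinearMap.star_eq_adjoint,
      ← ContinuousLinearMap.star_eq_adjoint, ← map_star, ← map_star, hc, ← op_star])
  exact quotient_aux π V₀ hf hne hinv

theorem backward_aux {A : Type*} [Ring A] [StarRing A] [Algebra ℂ A]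
    (n : ℕ) (hn : 0 < n) (q : A →⋆ₐ[ℂ] Matrix (Fin n) (Fin n) ℂ) :
    ∃ τ : A →ₗ[ℂ] ℂ, IsAmenableTrace τ := by
  have hn' : (n : ℂ) ≠ 0 := by exact_mod_cast hn.ne'
  let ql : A →ₗ[ℂ] Matrix (Fin n) (Fin n) ℂ := (q : A →ₐ[ℂ] Matrix (Fin n) (Fin n) ℂ).toLinearMap
  have hql : ∀ a, ql a = q a := fun a => rfl
  let τ : A →ₗ[ℂ] ℂ := (n : ℂ)⁻¹ • (Matrix.traceLinearMap (Fin n) ℂ ℂ ∘ₗ ql)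
  have hτ : ∀ a, τ a = (n : ℂ)⁻¹ * (q a).trace := fun a => rfl
  refine ⟨τ, ⟨?_, ?_, ?_⟩, fun _ => n, fun _ => ql, ?_, ?_, ?_⟩
  · rw [hτ, map_one, Matrix.trace_one, Fintype.card_fin, inv_mul_cancel₀ hn']
  · intro a
    rw [hτ, map_mul, map_star, Matrix.star_eq_conjTranspose]
    refine mul_nonneg ?_ (Matrix.posSemidef_conjTranspose_mul_self (q a)).trace_nonneg
    rw [← Complex.ofReal_natCast, ← Complex.ofReal_inv]
    exact Complex.zero_le_real.2 (by positivity)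
  · intro a b
    rw [hτ, hτ, map_mul, map_mul, Matrix.trace_mul_comm]
  · intro _
    refine ⟨hn, by rw [hql, map_one], ?_⟩
    intro m a v
    have := Matrix.posSemidef_conjTranspose_mul_self (∑ j, q (a j) * v j)
    refine Eq.mp (congrArg Matrix.PosSemidef ?_) this
    rw [Matrix.conjTranspose_sum, Finset.sum_mul]
    refine Finset.sum_congr rfl fun i _ => ?_
    rw [Finset.mul_sum]
    refine Finset.sum_congr rfl fun j _ => ?_
    rw [hql, map_mul, map_star, Matrix.star_eq_conjTranspose, Matrix.conjTranspose_mul]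
    simp only [mul_assoc]
  · intro a b
    simp [hql]
  · intro a
    have : (fun _ : ℕ => (ql a).trace / (n : ℂ)) = fun _ => τ a := by
      funext _
      rw [hτ, hql, div_eq_inv_mul]
    simp only [this]
    exact tendsto_const_nhds

/-- A separable unital C*-algebra with property T has an amenable trace if and only if
it has a nonzero finite-dimensional quotient. -/
theorem propertyT_amenable_trace_iff_finite_dimensional_quotient
    {A : Type*} [NormedRing A] [StarRing A] [CStarRing A] [NormedAlgebra ℂ A]
    [CompleteSpace A] [TopologicalSpace.SeparableSpace A]
    (hT : PropertyT A) :
    (∃ τ : A →ₗ[ℂ] ℂ, IsAmenableTrace τ) ↔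
      ∃ (n : ℕ) (_ : 0 < n) (q : A →⋆ₐ[ℂ] Matrix (Fin n) (Fin n) ℂ),
        Function.Surjective q := by
  constructor
  · rintro ⟨τ, hτ⟩
    exact forward_aux hT τ hτ
  · rintro ⟨n, hn, q, _⟩
    exact backward_aux n hn q
end

section
/- Let A be a unital C*-algebra with property T, π : A → M_n(ℂ) a finite-dimensional irreducible representation, and suppose σ : A → B(H) is a representation such that σ(A) contains no nonzero compact operator and σ has no subrepresentation unitarily equivalent to π. Then σ is not faithful. (Via Voiculescu's theorem, if σ were faithful it would be approximately unitarily equivalent to σ ⊕ π, hence would weakly contain π, hence by property T would contain π.) -/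
open Filter MulOpposite ContinuousLinearMap

set_option linter.unusedSectionVars false

/-- The Hilbert space `Hom(ℂⁿ, H)` with the Hilbert-Schmidt norm, as `n`-tuples in `H`. -/
abbrev HS (n : ℕ) (H : Type) : Type := PiLp 2 (fun _ : Fin n => H)

section aux
variable {n : ℕ} {H : Type} [NormedAddCommGroup H] [InnerProductSpace ℂ H] [CompleteSpace H]

local notation "EE" => EuclideanSpace ℂ (Fin n)

/-- Left multiplication. -/
noncomputable def opL (n : ℕ) (f : H →L[ℂ] H) : HS n H →L[ℂ] HS n H :=
  (PiLp.continuousLinearEquiv 2 ℂ (fun _ : Fin n => H)).symm.toContinuousLinearMap.comp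
    (ContinuousLinearMap.pi (fun i => f.comp (PiLp.proj 2 (fun _ : Fin n => H) i)))

/-- Right multiplication. -/
noncomputable def opR (H : Type) [NormedAddCommGroup H] [InnerProductSpace ℂ H]
    (g : EuclideanSpace ℂ (Fin n) →L[ℂ] EuclideanSpace ℂ (Fin n)) : HS n H →L[ℂ] HS n H :=
  (PiLp.continuousLinearEquiv 2 ℂ (fun _ : Fin n => H)).symm.toContinuousLinearMap.comp
    (ContinuousLinearMap.pi (fun i => ∑ j, (g (EuclideanSpace.single i 1) j) •
      (PiLp.proj 2 (fun _ : Fin n => H) j)))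

lemma opL_apply (f : H →L[ℂ] H) (x : HS n H) (i : Fin n) : opL n f x i = f (x i) := by
  simp [opL]

lemma opR_apply (g : EE →L[ℂ] EE) (x : HS n H) (i : Fin n) :
    opR H g x i = ∑ j, g (EuclideanSpace.single i 1) j • x j := by
  simp [opR]

lemma expand (y : EE) : y = ∑ j, y j • (EuclideanSpace.single j 1 : EE) := by
  ext k
  simp [Finset.sum_apply, Pi.single_apply]

lemma opR_mul (g h : EE →L[ℂ] EE) : opR H (g * h) = opR H h * opR H g := by
  ext x i
  simp only [ContinuousLinearMap.mul_apply, opR_apply, Finset.smul_sum, smul_smul]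
  rw [Finset.sum_comm]
  refine Finset.sum_congr rfl fun j _ => ?_
  rw [← Finset.sum_smul]
  congr 1
  conv_lhs => rw [expand (h (EuclideanSpace.single i 1))]
  simp [map_sum]

lemma entry_star (g : EE →L[ℂ] EE) (i j : Fin n) :
    (star g) (EuclideanSpace.single i 1) j = star (g (EuclideanSpace.single j 1) i) := by
  have h := ContinuousLinearMap.adjoint_inner_right g (EuclideanSpace.single j 1)
    (EuclideanSpace.single i 1)
  rw [EuclideanSpace.inner_single_left, EuclideanSpace.inner_single_right] at h
  simpa [ContinuousLinearMap.star_eq_adjoint] using h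

lemma opR_star (g : EE →L[ℂ] EE) : opR H (star g) = star (opR H g) := by
  rw [ContinuousLinearMap.star_eq_adjoint (opR H g), ContinuousLinearMap.eq_adjoint_iff]
  intro x y
  simp only [PiLp.inner_apply, opR_apply, sum_inner, inner_sum, inner_smul_left, inner_smul_right,
    entry_star]
  rw [Finset.sum_comm]
  simp

lemma opL_star (f : H →L[ℂ] H) : opL n (star f) = star (opL n f) := by
  rw [ContinuousLinearMap.star_eq_adjoint (opL n f), ContinuousLinearMap.eq_adjoint_iff]
  intro x y
  simp only [PiLp.inner_apply, opL_apply, ContinuousLinearMap.star_eq_adjoint,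
    ContinuousLinearMap.adjoint_inner_left]

variable {A : Type*} [Ring A] [StarRing A] [Algebra ℂ A]

/-- Left action. -/
noncomputable def LL (n : ℕ) (σ : A →⋆ₐ[ℂ] (H →L[ℂ] H)) :
    A →⋆ₐ[ℂ] (HS n H →L[ℂ] HS n H) where
  toFun a := opL n (σ a)
  map_one' := by ext x i; simp [opL_apply]
  map_mul' a b := by ext x i; simp [opL_apply]
  map_zero' := by ext x i; simp [opL_apply]
  map_add' a b := by ext x i; simp [opL_apply]
  commutes' r := by ext x i; simp [opL_apply, AlgHomClass.commutes, Algebra.algebraMap_eq_smul_one]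
  map_star' a := by rw [map_star, opL_star]

lemma opR_smul_one (r : ℂ) : opR H (r • (1 : EE →L[ℂ] EE)) = r • 1 := by
  ext x i; simp [opR_apply, PiLp.single_apply]

/-- Right action. -/
noncomputable def RR (H : Type) [NormedAddCommGroup H] [InnerProductSpace ℂ H] [CompleteSpace H]
    (π : A →⋆ₐ[ℂ] (EuclideanSpace ℂ (Fin n) →L[ℂ] EuclideanSpace ℂ (Fin n))) :
    Aᵐᵒᵖ →⋆ₐ[ℂ] (HS n H →L[ℂ] HS n H) where
  toFun a := opR H (π (unop a))
  map_one' := by simpa using opR_smul_one (n := n) (H := H) 1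
  map_mul' a b := by rw [unop_mul, map_mul, opR_mul]
  map_zero' := by ext x i; simp [opR_apply]
  map_add' a b := by ext x i; simp [opR_apply, add_smul, Finset.sum_add_distrib]
  commutes' r := by
    rw [MulOpposite.algebraMap_apply, unop_op, AlgHomClass.commutes, Algebra.algebraMap_eq_smul_one,
      opR_smul_one, Algebra.algebraMap_eq_smul_one]
  map_star' a := by rw [unop_star, map_star, opR_star]

lemma opL_opR (f : H →L[ℂ] H) (g : EE →L[ℂ] EE) : Commute (opL n f) (opR H g) := by
  ext x i
  simp [opL_apply, opR_apply]

/-- Right multiplication is composition. -/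
lemma opR_of (g : EE →L[ℂ] EE) (T : EE →L[ℂ] H) (x : HS n H)
    (hx : ∀ i, x i = T (EuclideanSpace.single i 1)) (i : Fin n) :
    opR H g x i = T (g (EuclideanSpace.single i 1)) := by
  rw [opR_apply]
  conv_rhs => rw [expand (g (EuclideanSpace.single i 1))]
  simp [hx]

lemma ext_single (T S : EE →L[ℂ] H)
    (h : ∀ i, T (EuclideanSpace.single i 1) = S (EuclideanSpace.single i 1)) : T = S := by
  ext x
  rw [expand x]
  simp [h]

/-- Schur: a nonzero intertwiner is a multiple of an isometry. -/
lemma schur (hn : 0 < n) (π : A →⋆ₐ[ℂ] (EE →L[ℂ] EE))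
    (hirr : ∀ S : Submodule ℂ EE, (∀ (a : A) (x : EE), x ∈ S → π a x ∈ S) → S = ⊥ ∨ S = ⊤)
    (σ : A →⋆ₐ[ℂ] (H →L[ℂ] H)) (T : EE →L[ℂ] H) (hT0 : T ≠ 0)
    (hT : ∀ a, T.comp (π a) = (σ a).comp T) :
    ∃ V : EE →L[ℂ] H, (∀ x, ‖V x‖ = ‖x‖) ∧ ∀ a : A, V.comp (π a) = (σ a).comp V := by
  have : Nonempty (Fin n) := ⟨⟨0, hn⟩⟩
  set Q : EE →L[ℂ] EE := (adjoint T).comp T with hQ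
  have hT' : ∀ a x, T (π a x) = σ a (T x) := fun a x => DFunLike.congr_fun (hT a) x
  have hcomm : ∀ a x, Q (π a x) = π a (Q x) := by
    intro a x
    refine ext_inner_right ℂ fun y => ?_
    have h1 : inner ℂ (π a (Q x)) y = inner ℂ (Q x) (π (star a) y) := by
      rw [map_star, ContinuousLinearMap.star_eq_adjoint, ContinuousLinearMap.adjoint_inner_right]
    rw [h1]
    simp only [hQ, ContinuousLinearMap.comp_apply, ContinuousLinearMap.adjoint_inner_left, hT']
    rw [map_star, ContinuousLinearMap.star_eq_adjoint, ContinuousLinearMap.adjoint_inner_right]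
  obtain ⟨μ, hμ⟩ := Module.End.exists_eigenvalue (Q : EE →ₗ[ℂ] EE)
  have hS : Module.End.eigenspace (Q : EE →ₗ[ℂ] EE) μ = ⊤ := by
    refine (hirr _ ?_).resolve_left hμ
    intro a x hx
    rw [Module.End.mem_eigenspace_iff] at hx ⊢
    have hx' : Q x = μ • x := hx
    change Q (π a x) = μ • π a x
    rw [hcomm, hx', map_smul]
  have hQx : ∀ x, Q x = μ • x := fun x => by
    have : x ∈ Module.End.eigenspace (Q : EE →ₗ[ℂ] EE) μ := by rw [hS]; trivial
    rw [Module.End.mem_eigenspace_iff] at this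
    exact this
  have hnorm : ∀ x, ‖T x‖ ^ 2 = μ.re * ‖x‖ ^ 2 := by
    intro x
    have h := ContinuousLinearMap.adjoint_inner_right T x (T x)
    have h2 : adjoint T (T x) = μ • x := hQx x
    rw [h2, inner_smul_right, inner_self_eq_norm_sq_to_K, inner_self_eq_norm_sq_to_K] at h
    have h3 := congrArg Complex.re h
    have h4 : ∀ r : ℝ, ((r : ℂ) ^ 2) = ((r ^ 2 : ℝ) : ℂ) := fun r => by push_cast; rfl
    erw [h4, h4, Complex.re_mul_ofReal, Complex.ofReal_re] at h3
    exact h3.symm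
  have hpos : 0 < μ.re := by
    by_contra hneg
    push Not at hneg
    apply hT0
    ext x
    have h1 := hnorm x
    have h2 : μ.re * ‖x‖ ^ 2 ≤ 0 := mul_nonpos_of_nonpos_of_nonneg hneg (by positivity)
    have h3 : ‖T x‖ ^ 2 = 0 := le_antisymm (h1 ▸ h2) (by positivity)
    simpa using h3
  refine ⟨(((Real.sqrt μ.re)⁻¹ : ℝ) : ℂ) • T, fun x => ?_, fun a => ?_⟩
  · have hs := Real.sqrt_pos.2 hpos
    have : ‖T x‖ = Real.sqrt μ.re * ‖x‖ := by
      rw [← Real.sqrt_sq (norm_nonneg (T x)), hnorm, Real.sqrt_mul hpos.le,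
        Real.sqrt_sq (norm_nonneg x)]
    rw [ContinuousLinearMap.smul_apply, norm_smul, this, Complex.norm_real, Real.norm_eq_abs,
      abs_of_pos (inv_pos.2 hs), inv_mul_cancel_left₀ hs.ne']
  · rw [ContinuousLinearMap.smul_comp, ContinuousLinearMap.comp_smul, hT]

end aux

/-- Let `A` be a separable unital C*-algebra with property T, `π : A → M_n(ℂ)` a
finite-dimensional irreducible representation, and `σ : A → B(H)` a representation whose
image contains no nonzero compact operator and which has no subrepresentation unitarily
equivalent to `π`. Assuming Voiculescu's theorem (if `σ` were faithful it would be
approximately unitarily equivalent to `σ ⊕ π`, hence would weakly contain `π`), `σ` is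
not faithful. -/
theorem sigma_not_faithful
    {A : Type*} [NormedRing A] [StarRing A] [CStarRing A] [NormedAlgebra ℂ A]
    [CompleteSpace A] [TopologicalSpace.SeparableSpace A]
    (hT : PropertyT A)
    {n : ℕ} (hn : 0 < n)
    (π : A →⋆ₐ[ℂ] (EuclideanSpace ℂ (Fin n) →L[ℂ] EuclideanSpace ℂ (Fin n)))
    (hirr : ∀ S : Submodule ℂ (EuclideanSpace ℂ (Fin n)),
      (∀ (a : A) (x : EuclideanSpace ℂ (Fin n)), x ∈ S → π a x ∈ S) → S = ⊥ ∨ S = ⊤)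
    {H : Type} [NormedAddCommGroup H] [InnerProductSpace ℂ H] [CompleteSpace H]
    (σ : A →⋆ₐ[ℂ] (H →L[ℂ] H))
    (hnocompact : ∀ a : A, IsCompactOperator (σ a) → σ a = 0)
    (hnosub : ¬∃ V : EuclideanSpace ℂ (Fin n) →L[ℂ] H,
      (∀ x, ‖V x‖ = ‖x‖) ∧ ∀ a : A, V.comp (π a) = (σ a).comp V)
    (hVoiculescu : Function.Injective σ →
      ∃ V : ℕ → (EuclideanSpace ℂ (Fin n) →L[ℂ] H),
        (∀ k (x : EuclideanSpace ℂ (Fin n)), ‖V k x‖ = ‖x‖) ∧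
        ∀ a : A, Tendsto (fun k => ‖(σ a).comp (V k) - (V k).comp (π a)‖) atTop (nhds 0)) :
    ¬Function.Injective σ := by
  intro hinj
  obtain ⟨V, hV, hlim⟩ := hVoiculescu hinj
  apply hnosub
  have hn' : (0 : ℝ) < Real.sqrt n := Real.sqrt_pos.2 (by exact_mod_cast hn)
  let c : ℂ := (((Real.sqrt n)⁻¹ : ℝ) : ℂ)
  have hc : ‖c‖ = (Real.sqrt n)⁻¹ := by
    simp only [c, Complex.norm_real, Real.norm_eq_abs, abs_of_pos (inv_pos.2 hn')]
  let W : ℕ → (EuclideanSpace ℂ (Fin n) →L[ℂ] H) := fun k => c • V k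
  let ξ : ℕ → HS n H := fun k => WithLp.toLp 2 (fun i => W k (EuclideanSpace.single i 1))
  have hξ : ∀ k i, ξ k i = W k (EuclideanSpace.single i 1) := fun k i => rfl
  obtain ⟨η, hη0, hη⟩ := hT (HS n H) (LL n σ) (RR H π) (fun a b => opL_opR _ _) ⟨ξ, by
    intro k
    rw [PiLp.norm_eq_of_L2]
    simp only [hξ, W, ContinuousLinearMap.smul_apply, norm_smul, hV, hc]
    have : (n : ℝ) ≠ 0 := by exact_mod_cast hn.ne'
    simp [this], by
    intro a
    rw [← tendsto_zero_iff_norm_tendsto_zero]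
    have hd : ∀ k i, (LL n σ a (ξ k) - RR H π (op a) (ξ k)) i =
        c • (((σ a).comp (V k) - (V k).comp (π a)) (EuclideanSpace.single i 1)) := by
      intro k i
      change opL n (σ a) (ξ k) i - opR H (π a) (ξ k) i = _
      rw [opL_apply, opR_of (π a) (W k) (ξ k) (hξ k), hξ]
      simp [W, smul_sub]
    have hpi : Tendsto (fun k => (WithLp.ofLp (LL n σ a (ξ k) - RR H π (op a) (ξ k)))) atTop
        (nhds (0 : Fin n → H)) := by
      rw [tendsto_pi_nhds]
      intro i
      have h0 := tendsto_zero_iff_norm_tendsto_zero.2 (hlim a)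
      have h1 := ((ContinuousLinearMap.apply ℂ H
        (EuclideanSpace.single i 1 : EuclideanSpace ℂ (Fin n))).continuous.tendsto 0).comp h0
      have h2 := h1.const_smul c
      simp only [map_zero, smul_zero] at h2
      refine h2.congr fun k => ?_
      exact (hd k i).symm
    exact ((PiLp.continuous_toLp 2 (fun _ : Fin n => H)).tendsto 0).comp hpi⟩
  let T : EuclideanSpace ℂ (Fin n) →L[ℂ] H :=
    ∑ i, (EuclideanSpace.proj i : EuclideanSpace ℂ (Fin n) →L[ℂ] ℂ).smulRight (η i)
  have hTi : ∀ i, η i = T (EuclideanSpace.single i 1) := by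
    intro i
    simp [T, ContinuousLinearMap.sum_apply, PiLp.single_apply]
  refine schur hn π hirr σ T ?_ ?_
  · intro h
    apply hη0
    ext i
    rw [hTi, h]; rfl
  · intro a
    apply ext_single
    intro i
    have h := congrArg (fun x : HS n H => x i) (hη a)
    change opL n (σ a) η i = opR H (π a) η i at h
    rw [opL_apply, opR_of (π a) T η hTi, hTi] at h
    exact h.symm
end

section
/- Let A be a unital, separable, nuclear C*-algebra with property T, and assume (i) every trace on a nuclear C*-algebra is amenable, and (ii) a property T algebra with an amenable trace has a nonzero finite-dimensional quotient, and (iii) Kazhdan projections of finite-dimensional irreducible representations lie in A. Then A ≅ B ⊕ C where B is finite-dimensional and C has no tracial states. -/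
open Filter Matrix MulOpposite
open scoped ComplexOrder

/-- Complete positivity for a linear map from `M_k(ℂ)` into a C*-algebra `A`
(positive matrices over `M_k(ℂ)` are mapped to positive matrices over `A`). -/
def IsCompletelyPositiveFromMatrix {A : Type*} [Ring A] [StarRing A] [Algebra ℂ A]
    {k : ℕ} (ψ : Matrix (Fin k) (Fin k) ℂ →ₗ[ℂ] A) : Prop :=
  ∀ (m : ℕ) (x : Matrix (Fin m) (Fin m) (Matrix (Fin k) (Fin k) ℂ)),
    (∃ y : Matrix (Fin m) (Fin m) (Matrix (Fin k) (Fin k) ℂ), x = star y * y) → ∃ z : Matrix (Fin m) (Fin m) A, x.map ψ = star z * z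

/-- Nuclearity (in the form of the completely positive approximation property): the identity
of `A` approximately factors through matrix algebras by u.c.p. maps, in point-norm. -/
def IsNuclear (A : Type*) [NormedRing A] [StarRing A] [NormedAlgebra ℂ A] : Prop :=
  ∃ (k : ℕ → ℕ) (φ : ∀ n : ℕ, A →ₗ[ℂ] Matrix (Fin (k n)) (Fin (k n)) ℂ)
    (ψ : ∀ n : ℕ, Matrix (Fin (k n)) (Fin (k n)) ℂ →ₗ[ℂ] A),
    (∀ n, φ n 1 = 1 ∧ IsCompletelyPositive (φ n) ∧ ψ n 1 = 1 ∧
      IsCompletelyPositiveFromMatrix (ψ n)) ∧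
    ∀ a : A, Tendsto (fun n => ‖ψ n (φ n a) - a‖) atTop (nhds 0)

set_option linter.all false

open UniformSpace

section PartOne

/-- bound for a star-compatible action on a pre-Hilbert space -/
lemma action_bound {B : Type*} [CStarAlgebra B] {E : Type*} [SeminormedAddCommGroup E]
    [InnerProductSpace ℂ E] (α : B →ₐ[ℂ] Module.End ℂ E)
    (hα : ∀ a x y, inner ℂ (α a x) y = inner ℂ x (α (star a) y)) (a : B) (x : E) :
    ‖α a x‖ ≤ ‖a‖ * ‖x‖ := by
  let _ := CStarAlgebra.spectralOrder B
  let _ := CStarAlgebra.spectralOrderedRing B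
  have h0 : 0 ≤ algebraMap ℝ B (‖a‖ ^ 2) - star a * a :=
    sub_nonneg.mpr CStarAlgebra.star_mul_le_algebraMap_norm_sq
  obtain ⟨c, hc⟩ := CStarAlgebra.nonneg_iff_eq_star_mul_self.mp h0
  have h1 : (‖α c x‖ : ℝ) ^ 2 = ‖a‖ ^ 2 * ‖x‖ ^ 2 - ‖α a x‖ ^ 2 := by
    have e1 : ∀ b : B, inner ℂ x (α (star b * b) x) = ((‖α b x‖ : ℝ) ^ 2 : ℂ) := by
      intro b
      rw [map_mul, Module.End.mul_apply, ← star_star b, ← hα, star_star,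
        inner_self_eq_norm_sq_to_K]
      simp
    have h2 := e1 c
    rw [← hc, map_sub, LinearMap.sub_apply, inner_sub_right, e1] at h2
    have e3 : algebraMap ℝ B (‖a‖ ^ 2) = algebraMap ℂ B ((‖a‖ ^ 2 : ℝ) : ℂ) := by
      rw [IsScalarTower.algebraMap_apply ℝ ℂ B]; rfl
    rw [e3, AlgHom.commutes, Module.algebraMap_end_apply, inner_smul_right,
      inner_self_eq_norm_sq_to_K] at h2
    apply Complex.ofReal_injective
    push_cast
    rw [← h2]
    simp
  have h4 : ‖α a x‖ ^ 2 ≤ (‖a‖ * ‖x‖) ^ 2 := by nlinarith [sq_nonneg ‖α c x‖]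
  exact le_of_sq_le_sq h4 (by positivity)

/-- extension to the completion -/
lemma exists_rep {B : Type*} [CStarAlgebra B] {E : Type*} [SeminormedAddCommGroup E]
    [InnerProductSpace ℂ E] (α : B →ₐ[ℂ] Module.End ℂ E)
    (hα : ∀ a x y, inner ℂ (α a x) y = inner ℂ x (α (star a) y)) :
    ∃ P : B →⋆ₐ[ℂ] (Completion E →L[ℂ] Completion E),
      ∀ a (x : E), P a (x : Completion E) = ((α a x : E) : Completion E) := by
  let β : B → (E →L[ℂ] E) := fun a => (α a).mkContinuous ‖a‖ (action_bound α hα a)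
  have hβ : ∀ a x, β a x = α a x := fun a x => rfl
  have hc : ∀ a (x : E), (β a).completion (x : Completion E) = ((α a x : E) : Completion E) := by
    intro a x
    simp [hβ]
  refine ⟨{ toFun := fun a => (β a).completion, map_one' := ?_, map_mul' := ?_,
            map_zero' := ?_, map_add' := ?_, commutes' := ?_, map_star' := ?_ }, ?_⟩
  · ext c
    induction c using Completion.induction_on with
    | hp => apply isClosed_eq <;> fun_prop
    | ih c => simp [hc]
  · intro a b
    ext c
    induction c using Completion.induction_on with
    | hp => apply isClosed_eq <;> fun_prop
    | ih c => simp [hc]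
  · ext c
    induction c using Completion.induction_on with
    | hp => apply isClosed_eq <;> fun_prop
    | ih c => simp [hc, Completion.coe_zero]
  · intro a b
    ext c
    induction c using Completion.induction_on with
    | hp => apply isClosed_eq <;> fun_prop
    | ih c => simp [hc, Completion.coe_add]
  · intro r
    ext c
    induction c using Completion.induction_on with
    | hp => apply isClosed_eq <;> fun_prop
    | ih c => simp [hc, Algebra.algebraMap_eq_smul_one]
  · intro a
    refine (ContinuousLinearMap.eq_adjoint_iff _ _).mpr ?_
    intro x y
    induction x, y using Completion.induction_on₂ with
    | hp => apply isClosed_eq <;> fun_prop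
    | ih x y => simp [hc, hα]
  · exact hc

end PartOne

section PartTwo
open TensorProduct

/-- a tensor product of two representations -/
lemma exists_tensor_rep {B C : Type*} [CStarAlgebra B] [CStarAlgebra C]
    {G L : Type*} [NormedAddCommGroup G] [InnerProductSpace ℂ G] [CompleteSpace G]
    [NormedAddCommGroup L] [InnerProductSpace ℂ L] [CompleteSpace L]
    (P : B →⋆ₐ[ℂ] (G →L[ℂ] G)) (R : C →⋆ₐ[ℂ] (L →L[ℂ] L)) :
    ∃ (PL : B →⋆ₐ[ℂ] (Completion (G ⊗[ℂ] L) →L[ℂ] Completion (G ⊗[ℂ] L)))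
      (PR : C →⋆ₐ[ℂ] (Completion (G ⊗[ℂ] L) →L[ℂ] Completion (G ⊗[ℂ] L))),
      (∀ a g l, PL a ((g ⊗ₜ[ℂ] l : G ⊗[ℂ] L) : Completion (G ⊗[ℂ] L)) =
        ((P a g ⊗ₜ[ℂ] l : G ⊗[ℂ] L) : Completion (G ⊗[ℂ] L))) ∧
      (∀ b g l, PR b ((g ⊗ₜ[ℂ] l : G ⊗[ℂ] L) : Completion (G ⊗[ℂ] L)) =
        ((g ⊗ₜ[ℂ] R b l : G ⊗[ℂ] L) : Completion (G ⊗[ℂ] L))) ∧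
      ∀ a b, Commute (PL a) (PR b) := by
  let toEndG : (G →L[ℂ] G) →ₐ[ℂ] Module.End ℂ G :=
    { (ContinuousLinearMap.toLinearMapRingHom : (G →L[ℂ] G) →+* (G →ₗ[ℂ] G)) with
      commutes' := fun r => rfl }
  let toEndL : (L →L[ℂ] L) →ₐ[ℂ] Module.End ℂ L :=
    { (ContinuousLinearMap.toLinearMapRingHom : (L →L[ℂ] L) →+* (L →ₗ[ℂ] L)) with
      commutes' := fun r => rfl }
  let α : B →ₐ[ℂ] Module.End ℂ (G ⊗[ℂ] L) :=
    (Module.End.rTensorAlgHom ℂ G L).comp (toEndG.comp P.toAlgHom)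
  let β : C →ₐ[ℂ] Module.End ℂ (G ⊗[ℂ] L) :=
    (Module.End.lTensorAlgHom ℂ L G).comp (toEndL.comp R.toAlgHom)
  have hα : ∀ a g l, α a (g ⊗ₜ[ℂ] l) = P a g ⊗ₜ[ℂ] l := fun a g l => rfl
  have hβ : ∀ a g l, β a (g ⊗ₜ[ℂ] l) = g ⊗ₜ[ℂ] R a l := fun a g l => rfl
  have adjP : ∀ a x y, inner ℂ (P a x) y = inner ℂ x (P (star a) y) := by
    intro a x y
    rw [map_star, ContinuousLinearMap.star_eq_adjoint, ContinuousLinearMap.adjoint_inner_right]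
  have adjR : ∀ a x y, inner ℂ (R a x) y = inner ℂ x (R (star a) y) := by
    intro a x y
    rw [map_star, ContinuousLinearMap.star_eq_adjoint, ContinuousLinearMap.adjoint_inner_right]
  obtain ⟨PL, hPL⟩ := exists_rep α (by
    intro a x y
    induction x with
    | zero => simp
    | add x₁ x₂ h1 h2 => simp [inner_add_left, h1, h2]
    | tmul g l =>
      induction y with
      | zero => simp
      | add x₁ x₂ h1 h2 => simp [inner_add_right, h1, h2]
      | tmul g' l' => simp [hα, adjP])
  obtain ⟨PR, hPR⟩ := exists_rep β (by
    intro a x y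
    induction x with
    | zero => simp
    | add x₁ x₂ h1 h2 => simp [inner_add_left, h1, h2]
    | tmul g l =>
      induction y with
      | zero => simp
      | add x₁ x₂ h1 h2 => simp [inner_add_right, h1, h2]
      | tmul g' l' => simp [hβ, adjR])
  refine ⟨PL, PR, fun a g l => by rw [hPL, hα], fun a g l => by rw [hPR, hβ], ?_⟩
  intro a b
  change PL a * PR b = PR b * PL a
  ext c
  induction c using Completion.induction_on with
  | hp => apply isClosed_eq <;> fun_prop
  | ih c =>
    simp only [mul_apply_eq_comp, hPL, hPR]
    congr 1
    induction c with
    | zero => simp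
    | add x₁ x₂ h1 h2 => simp [h1, h2]
    | tmul g l => simp [hα, hβ]

/-- GNS-type construction from a positive semidefinite form. -/
lemma exists_rep_core {B : Type*} [CStarAlgebra B] {E : Type} [AddCommGroup E] [Module ℂ E]
    (c : PreInnerProductSpace.Core ℂ E) (α : B →ₐ[ℂ] Module.End ℂ E)
    (hα : ∀ a x y, c.inner (α a x) y = c.inner x (α (star a) y)) :
    ∃ (H : Type) (_ : NormedAddCommGroup H) (_ : InnerProductSpace ℂ H) (_ : CompleteSpace H)
      (P : B →⋆ₐ[ℂ] (H →L[ℂ] H)) (ι : E →ₗ[ℂ] H),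
      (∀ x y, inner ℂ (ι x) (ι y) = c.inner x y) ∧ (∀ a x, P a (ι x) = ι (α a x)) ∧
      DenseRange ι := by
  let i2 : SeminormedAddCommGroup E :=
    @InnerProductSpace.Core.toSeminormedAddCommGroup ℂ E _ _ _ c
  let i3 : InnerProductSpace ℂ E := InnerProductSpace.ofCore c
  obtain ⟨P, hP⟩ := exists_rep α hα
  refine ⟨Completion E, inferInstance, inferInstance, inferInstance, P,
    (Completion.toComplL : E →L[ℂ] Completion E).toLinearMap, ?_, ?_, ?_⟩
  · intro x y
    exact Completion.inner_coe x y
  · intro a x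
    exact hP a x
  · exact Completion.denseRange_coe

/-- the GNS representation of a positive functional -/
lemma exists_gns {B : Type} [CStarAlgebra B] (τ : B →ₗ[ℂ] ℂ) (hpos : ∀ a, 0 ≤ τ (star a * a)) :
    ∃ (L : Type) (_ : NormedAddCommGroup L) (_ : InnerProductSpace ℂ L) (_ : CompleteSpace L)
      (R : B →⋆ₐ[ℂ] (L →L[ℂ] L)) (Ω : L),
      (∀ a b, inner ℂ (R a Ω) (R b Ω) = τ (star a * b)) ∧ Dense (Set.range fun b => R b Ω) := by
  have hstar : ∀ a, τ (star a) = star (τ a) := by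
    intro a
    have key : ∀ c : ℂ, star c * c * τ 1 + star c * τ a + c * τ (star a) + τ (star a * a) =
        τ (star (a + algebraMap ℂ B c) * (a + algebraMap ℂ B c)) := by
      intro c
      simp only [Algebra.algebraMap_eq_smul_one, star_add, star_smul, star_one, add_mul, mul_add,
        map_add, smul_mul_assoc, mul_smul_comm, one_mul, mul_one, map_smul, smul_eq_mul]
      ring
    have im0 : ∀ b, (τ (star b * b)).im = 0 := fun b => (Complex.nonneg_iff.mp (hpos b)).2.symm
    have h1 : (τ 1).im = 0 := by simpa using im0 1
    have ha := im0 a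
    have k1 := congrArg Complex.im (key 1)
    have k2 := congrArg Complex.im (key Complex.I)
    rw [im0] at k1 k2
    simp [h1, ha] at k1 k2
    apply Complex.ext
    · simp; linarith
    · simp; linarith
  let c : PreInnerProductSpace.Core ℂ B :=
    { inner := fun a b => τ (star a * b)
      conj_inner_symm := by
        intro a b
        change star (τ _) = _
        rw [← hstar]; simp
      re_inner_nonneg := fun a => (Complex.nonneg_iff.mp (hpos a)).1
      add_left := by intro a b c; simp [add_mul]
      smul_left := by intro a b c; simp }
  obtain ⟨H, n1, n2, n3, R, ι, h1, h2, h3⟩ := exists_rep_core c (Algebra.lmul ℂ B) (by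
    intro a x y
    change τ (star (a * x) * y) = τ (star x * (star a * y))
    simp [mul_assoc])
  have h4 : ∀ b, R b (ι 1) = ι b := by
    intro b
    rw [h2]
    simp
  refine ⟨H, n1, n2, n3, R, ι 1, ?_, ?_⟩
  · intro a b
    rw [h4, h4, h1]
    rfl
  · have : (fun b => R b (ι 1)) = fun b => ι b := funext h4
    rw [this]
    exact h3
end PartTwo

section PartThree

lemma herm_of_nonneg {E : Type*} [AddCommGroup E] [Module ℂ E] (s : E → E → ℂ)
    (hal : ∀ x y z, s (x + y) z = s x z + s y z) (hsl : ∀ (c : ℂ) x y, s (c • x) y = star c * s x y)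
    (har : ∀ x y z, s x (y + z) = s x y + s x z) (hsr : ∀ (c : ℂ) x y, s x (c • y) = c * s x y)
    (hpos : ∀ x, 0 ≤ s x x) (x y : E) : star (s y x) = s x y := by
  have im0 : ∀ b, (s b b).im = 0 := fun b => (Complex.nonneg_iff.mp (hpos b)).2.symm
  have k1 := im0 (x + y)
  have k2 := im0 (x + Complex.I • y)
  simp only [hal, har, hsl, hsr, Complex.add_im, im0] at k1 k2
  simp [im0] at k1 k2
  apply Complex.ext
  · simp; linarith
  · simp; linarith

variable {A : Type} [CStarAlgebra A]

/-- the block form of a completely positive map -/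
noncomputable def blockForm {k : ℕ} (φ : A →ₗ[ℂ] Matrix (Fin k) (Fin k) ℂ) (u w : ℕ → A) : ℂ :=
  ∑ i : Fin k, ∑ j : Fin k, φ (star (u i) * w j) i j

lemma blockForm_nonneg {k : ℕ} (φ : A →ₗ[ℂ] Matrix (Fin k) (Fin k) ℂ)
    (h : IsCompletelyPositive φ) (u : ℕ → A) : 0 ≤ blockForm φ u u := by
  rcases Nat.eq_zero_or_pos k with rfl | hk
  · simp [blockForm]
  · have := h k (fun i => u i) (fun i => Matrix.of fun r _ => if r = i then 1 else 0)
    have h2 := this.diag_nonneg (i := ⟨0, hk⟩)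
    convert h2 using 1
    simp [blockForm, Matrix.sum_apply, Matrix.mul_apply, apply_ite]

lemma exists_dilation (k : ℕ → ℕ) (φ : ∀ n : ℕ, A →ₗ[ℂ] Matrix (Fin (k n)) (Fin (k n)) ℂ)
    (hcp : ∀ n, IsCompletelyPositive (φ n)) :
    ∃ (G : Type) (_ : NormedAddCommGroup G) (_ : InnerProductSpace ℂ G) (_ : CompleteSpace G)
      (P : A →⋆ₐ[ℂ] (G →L[ℂ] G)) (v : ∀ n : ℕ, ℕ → Fin (k n) → G),
      ∀ a n l l' i j, inner ℂ (v n l i) (P a (v n l' j)) = if l = l' then φ n a i j else 0 := by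
  let s : ((ℕ × ℕ) →₀ (ℕ → A)) → ((ℕ × ℕ) →₀ (ℕ → A)) → ℂ :=
    fun x y => x.sum fun p u => blockForm (φ p.1) u (y p)
  have bal : ∀ n u u' w, blockForm (φ n) (u + u') w = blockForm (φ n) u w + blockForm (φ n) u' w := by
    intro n u u' w
    simp [blockForm, add_mul, Finset.sum_add_distrib]
  have bar : ∀ n u u' w, blockForm (φ n) w (u + u') = blockForm (φ n) w u + blockForm (φ n) w u' := by
    intro n u u' w
    simp [blockForm, mul_add, Finset.sum_add_distrib]
  have bsl : ∀ n (c : ℂ) u w, blockForm (φ n) (c • u) w = star c * blockForm (φ n) u w := by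
    intro n c u w
    simp [blockForm, Finset.mul_sum]
  have bsr : ∀ n (c : ℂ) u w, blockForm (φ n) u (c • w) = c * blockForm (φ n) u w := by
    intro n c u w
    simp [blockForm, Finset.mul_sum]
  have b0 : ∀ n w, blockForm (φ n) 0 w = 0 := by
    intro n w
    simp [blockForm]
  have hal : ∀ x y z, s (x + y) z = s x z + s y z := by
    intro x y z
    exact Finsupp.sum_add_index' (fun p => b0 _ _) (fun p u u' => bal _ _ _ _)
  have hsl : ∀ (c : ℂ) x y, s (c • x) y = star c * s x y := by
    intro c x y
    change (c • x).sum _ = _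
    rw [Finsupp.sum_smul_index' (fun p => b0 p.1 (y p))]
    simp only [bsl]
    rw [← Finsupp.mul_sum]
  have har : ∀ x y z, s x (y + z) = s x y + s x z := by
    intro x y z
    simp only [s, Finsupp.add_apply, bar]
    exact Finsupp.sum_add
  have hsr : ∀ (c : ℂ) x y, s x (c • y) = c * s x y := by
    intro c x y
    simp only [s, Finsupp.smul_apply, bsr]
    rw [← Finsupp.mul_sum]
  have hpos : ∀ x, 0 ≤ s x x := fun x => Finset.sum_nonneg fun p _ =>
    blockForm_nonneg _ (hcp _) _
  let c : PreInnerProductSpace.Core ℂ ((ℕ × ℕ) →₀ (ℕ → A)) :=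
    { inner := s
      conj_inner_symm := herm_of_nonneg s hal hsl har hsr hpos
      re_inner_nonneg := fun a => (Complex.nonneg_iff.mp (hpos a)).1
      add_left := hal
      smul_left := fun x y r => hsl r x y }
  obtain ⟨H, n1, n2, n3, P, ι, h1, h2, h3⟩ := exists_rep_core c (Algebra.lsmul ℂ ℂ ((ℕ × ℕ) →₀ (ℕ → A)) : A →ₐ[ℂ] _) (by
    intro a x y
    change s (a • x) y = s x (star a • y)
    change (a • x).sum _ = _
    rw [Finsupp.sum_smul_index' (fun p => b0 p.1 (y p))]
    simp [s, blockForm, mul_assoc])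
  refine ⟨H, n1, n2, n3, P, fun n l i => ι (Finsupp.single (n, l) (Pi.single (i : ℕ) 1)), ?_⟩
  intro a n l l' i j
  rw [h2, h1]
  change s _ (a • _) = _
  simp only [s]
  rw [Finsupp.sum_single_index (h := fun (p : ℕ × ℕ) (u : ℕ → A) => blockForm (φ p.1) u
    ((a • (Finsupp.single (n, l') (Pi.single (j : ℕ) 1) : (ℕ × ℕ) →₀ (ℕ → A))) p)) (b0 _ _)]
  by_cases hl : l = l'
  · subst hl
    simp only [Finsupp.smul_apply, Finsupp.single_eq_same, if_true, blockForm]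
    rw [Finset.sum_eq_single i, Finset.sum_eq_single j]
    · simp
    · intro b _ hb
      have : (b : ℕ) ≠ j := fun h => hb (Fin.ext h)
      simp [Pi.single_apply, this]
    · simp
    · intro b _ hb
      have : (b : ℕ) ≠ i := fun h => hb (Fin.ext h)
      simp [Pi.single_apply, this]
    · simp
  · have : (n, l') ≠ (n, l) := by simpa [eq_comm] using hl
    simp [hl, Finsupp.single_apply, blockForm, eq_comm]

end PartThree

section PartFour
open scoped TensorProduct

lemma inner_self_cplx {H : Type*} [SeminormedAddCommGroup H] [InnerProductSpace ℂ H] (x : H) :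
    inner ℂ x x = ((‖x‖ ^ 2 : ℝ) : ℂ) := by
  rw [inner_self_eq_norm_sq_to_K]
  simp

lemma cp_from_matrix_gram {A : Type*} [Ring A] [StarRing A] [Algebra ℂ A] {k : ℕ}
    (ψ : Matrix (Fin k) (Fin k) ℂ →ₗ[ℂ] A) (h : IsCompletelyPositiveFromMatrix ψ) :
    ∃ z : Fin k → Fin k → A, ∀ i j, ψ (Matrix.single i j 1) = ∑ l, star (z l i) * z l j := by
  rcases Nat.eq_zero_or_pos k with rfl | hk
  · exact ⟨fun _ _ => 0, fun i => i.elim0⟩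
  · let i0 : Fin k := ⟨0, hk⟩
    obtain ⟨z, hz⟩ := h k (Matrix.of fun i j => Matrix.single i j 1)
      ⟨Matrix.of fun i j => if i = i0 then Matrix.single i0 j 1 else 0, by
        ext1 i j
        simp [Matrix.mul_apply, Matrix.star_apply, apply_ite, Matrix.star_eq_conjTranspose]⟩
    refine ⟨z, fun i j => ?_⟩
    have := congrFun (congrFun hz i) j
    simpa [Matrix.mul_apply, Matrix.star_apply] using this

lemma state_bound {B : Type} [CStarAlgebra B] (τ : B →ₗ[ℂ] ℂ) (hpos : ∀ a, 0 ≤ τ (star a * a))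
    (h1 : τ 1 = 1) (x : B) : ‖τ x‖ ≤ ‖x‖ := by
  obtain ⟨L, _, _, _, R, Ω, hR, -⟩ := exists_gns τ hpos
  have hΩ : ‖Ω‖ = 1 := by
    have := hR 1 1
    simp only [map_one, one_apply_eq_self, star_one, mul_one, h1] at this
    rw [inner_self_cplx] at this
    have h2 : ‖Ω‖ ^ 2 = 1 := by exact_mod_cast this
    nlinarith [norm_nonneg Ω]
  have := hR 1 x
  simp only [map_one, one_apply_eq_self, star_one, one_mul] at this
  rw [← this]
  calc _ ≤ ‖Ω‖ * ‖R x Ω‖ := norm_inner_le_norm _ _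
    _ ≤ ‖Ω‖ * (‖R x‖ * ‖Ω‖) := by gcongr; exact (R x).le_opNorm Ω
    _ = ‖R x‖ := by rw [hΩ]; ring
    _ ≤ ‖x‖ := NonUnitalStarAlgHom.norm_apply_le R x

lemma inner_star_rep {B : Type*} [CStarAlgebra B] {H : Type*} [NormedAddCommGroup H]
    [InnerProductSpace ℂ H] [CompleteSpace H] (P : B →⋆ₐ[ℂ] (H →L[ℂ] H)) (a : B) (x y : H) :
    inner ℂ (P a x) y = inner ℂ x (P (star a) y) := by
  rw [map_star, ContinuousLinearMap.star_eq_adjoint, ContinuousLinearMap.adjoint_inner_right]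

lemma exists_central {A : Type} [CStarAlgebra A] (hnuc : IsNuclear A) (hT : PropertyT A)
    (τ : A →ₗ[ℂ] ℂ) (hτ : IsTracialState τ) :
    ∃ (G : Type) (_ : NormedAddCommGroup G) (_ : InnerProductSpace ℂ G) (_ : CompleteSpace G)
      (P : A →⋆ₐ[ℂ] (G →L[ℂ] G))
      (L : Type) (_ : NormedAddCommGroup L) (_ : InnerProductSpace ℂ L) (_ : CompleteSpace L)
      (R : Aᵐᵒᵖ →⋆ₐ[ℂ] (L →L[ℂ] L))
      (PL : A →⋆ₐ[ℂ] (Completion (G ⊗[ℂ] L) →L[ℂ] Completion (G ⊗[ℂ] L)))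
      (PR : Aᵐᵒᵖ →⋆ₐ[ℂ] (Completion (G ⊗[ℂ] L) →L[ℂ] Completion (G ⊗[ℂ] L)))
      (ζ : Completion (G ⊗[ℂ] L)),
      (∀ a, P a = 0 → a = 0) ∧
      (∀ q, (∀ a, q * a = a * q) → star q = q → q * q = q → τ q = 0 → R (op q) = 0) ∧
      (∀ a g l, PL a ((g ⊗ₜ[ℂ] l : G ⊗[ℂ] L) : Completion (G ⊗[ℂ] L)) =
        ((P a g ⊗ₜ[ℂ] l : G ⊗[ℂ] L) : Completion (G ⊗[ℂ] L))) ∧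
      (∀ b g l, PR b ((g ⊗ₜ[ℂ] l : G ⊗[ℂ] L) : Completion (G ⊗[ℂ] L)) =
        ((g ⊗ₜ[ℂ] R b l : G ⊗[ℂ] L) : Completion (G ⊗[ℂ] L))) ∧
      ζ ≠ 0 ∧ ∀ a, PL a ζ = PR (op a) ζ := by
  obtain ⟨k, φ, ψ, hn, hlim⟩ := hnuc
  obtain ⟨hτ1, hτp, hτt⟩ := hτ
  obtain ⟨G, _, _, _, P, v, hv⟩ := exists_dilation k φ (fun n => (hn n).2.1)
  let τ' : Aᵐᵒᵖ →ₗ[ℂ] ℂ := τ ∘ₗ (MulOpposite.opLinearEquiv ℂ : A ≃ₗ[ℂ] Aᵐᵒᵖ).symm.toLinearMap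
  have hτ' : ∀ a, τ' a = τ (unop a) := fun a => rfl
  obtain ⟨L, _, _, _, R, Ω, hR, hd⟩ := exists_gns τ' (by
    intro a
    rw [hτ', unop_mul, unop_star, hτt]
    exact hτp _)
  obtain ⟨PL, PR, hPL, hPR, hcomm⟩ := exists_tensor_rep P R
  have hψ : ∀ a, Tendsto (fun n => ψ n (φ n a)) atTop (nhds a) := fun a =>
    tendsto_iff_norm_sub_tendsto_zero.mpr (hlim a)
  have hτc : Continuous τ := by
    have := (LinearMap.mkContinuous τ 1 (fun x => by
      simpa using state_bound τ hτp hτ1 x)).continuous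
    exact this
  choose z hz using fun n => cp_from_matrix_gram (ψ n) (hn n).2.2.2
  let ξ : ℕ → Completion (G ⊗[ℂ] L) := fun n => ∑ j, ∑ l : Fin (k n),
    ((v n l j ⊗ₜ[ℂ] R (op (z n l j)) Ω : G ⊗[ℂ] L) : Completion (G ⊗[ℂ] L))
  have hψe : ∀ n (M : Matrix (Fin (k n)) (Fin (k n)) ℂ), ψ n M =
      ∑ j, ∑ j', M j j' • ∑ l, star (z n l j) * z n l j' := by
    intro n M
    conv_lhs => rw [Matrix.matrix_eq_sum_single M]
    simp only [map_sum]
    refine Finset.sum_congr rfl fun j _ => Finset.sum_congr rfl fun j' _ => ?_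
    rw [← hz, ← map_smul, Matrix.smul_single, smul_eq_mul, mul_one]
  have key : ∀ n a b, inner ℂ (ξ n) (PL a (PR (op b) (ξ n))) = τ (ψ n (φ n a) * b) := by
    intro n a b
    simp only [ξ, map_sum, hPR, hPL, sum_inner, inner_sum, Completion.inner_coe,
      TensorProduct.inner_tmul, hv]
    have e : ∀ x y : A, inner ℂ (R (op x) Ω) (R (op b) (R (op y) Ω)) = τ (star x * y * b) := by
      intro x y
      have := hR (op x) (op b * op y)
      rw [map_mul, mul_apply_eq_comp] at this
      rw [this, hτ']
      simp only [unop_mul, unop_star, unop_op]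
      rw [hτt, ← mul_assoc]
    simp only [e, hψe, Fin.val_inj]
    simp only [Finset.sum_mul, map_sum, Finset.smul_sum, smul_mul_assoc, map_smul, smul_eq_mul,
      ite_mul, zero_mul, Finset.sum_ite_eq, Finset.mem_univ, if_true]
    refine (Finset.sum_congr rfl fun j _ => Finset.sum_comm).trans ?_
    rw [Finset.sum_comm]
    simp
  have hξ1 : ∀ n, ‖ξ n‖ = 1 := by
    intro n
    have := key n 1 1
    simp only [op_one, map_one, one_apply_eq_self, (hn n).1, (hn n).2.2.1,
      mul_one, hτ1] at this
    rw [inner_self_cplx] at this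
    have h2 : ‖ξ n‖ ^ 2 = 1 := by exact_mod_cast this
    nlinarith [norm_nonneg (ξ n)]
  obtain ⟨ζ, hζ0, hζ⟩ := hT _ PL PR hcomm ⟨ξ, hξ1, by
    intro a
    have hsq : ∀ n, ((‖PL a (ξ n) - PR (op a) (ξ n)‖ ^ 2 : ℝ) : ℂ) = τ (ψ n (φ n (star a * a)))
        - τ (ψ n (φ n a) * star a) - τ (ψ n (φ n (star a)) * a) + τ (a * star a) := by
      intro n
      have e0 := inner_self_cplx (PL a (ξ n) - PR (op a) (ξ n))
      have k1 := key n (star a * a) 1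
      have k2 := key n a (star a)
      have k3 := key n (star a) a
      have k4 := key n 1 (a * star a)
      have hc : PL a (PR (op (star a)) (ξ n)) = PR (op (star a)) (PL a (ξ n)) := by
        have := DFunLike.congr_fun (hcomm a (op (star a))) (ξ n)
        exact this
      rw [hc, op_star, ← inner_star_rep] at k2
      rw [← inner_star_rep] at k3
      rw [op_one, map_one, map_mul, one_apply_eq_self,
        mul_apply_eq_comp, ← inner_star_rep, mul_one] at k1
      rw [map_one, one_apply_eq_self, (hn n).1, (hn n).2.2.1, one_mul, op_mul,
        map_mul, mul_apply_eq_comp, op_star, ← inner_star_rep] at k4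
      rw [inner_sub_left, inner_sub_right, inner_sub_right, k1, k2, k3, k4] at e0
      rw [← e0]
      ring
    have h1 : Tendsto (fun n => ((‖PL a (ξ n) - PR (op a) (ξ n)‖ ^ 2 : ℝ) : ℂ)) atTop (nhds 0) := by
      have h2 : Tendsto (fun n => τ (ψ n (φ n (star a * a)))
        - τ (ψ n (φ n a) * star a) - τ (ψ n (φ n (star a)) * a) + τ (a * star a)) atTop
          (nhds (τ (star a * a) - τ (a * star a) - τ (star a * a) + τ (a * star a))) := by
        refine Tendsto.add_const _ (Tendsto.sub (Tendsto.sub ?_ ?_) ?_)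
        · exact (hτc.tendsto _).comp (hψ _)
        · exact (hτc.tendsto _).comp ((hψ _).mul_const _)
        · exact (hτc.tendsto _).comp ((hψ _).mul_const _)
      simp only [hsq]
      convert h2 using 2
      ring
    have h2 := (Complex.continuous_re.tendsto _).comp h1
    have h3 := (Real.continuous_sqrt.tendsto _).comp h2
    simp only [Function.comp_def, Complex.ofReal_re, Complex.zero_re, Real.sqrt_zero] at h3
    refine h3.congr fun n => ?_
    exact Real.sqrt_sq (norm_nonneg _)⟩
  refine ⟨G, _, _, ‹_›, P, L, _, _, ‹_›, R, PL, PR, ζ, ?_, ?_, hPL, hPR, hζ0, hζ⟩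
  · intro a ha
    have h0 : ∀ n, φ n a = 0 := by
      intro n
      ext i j
      have := hv a n 0 0 i j
      simpa [ha] using this.symm
    have := hψ a
    simp only [h0, map_zero] at this
    exact (tendsto_nhds_unique this tendsto_const_nhds)
  · intro q hq hs hqq hq0
    have h1 : R (op q) Ω = 0 := by
      have := hR (op q) (op q)
      rw [hτ'] at this
      simp only [unop_mul, unop_star, unop_op, hs, hqq, hq0] at this
      exact inner_self_eq_zero.mp this
    have h2 : (R (op q) : L → L) = (0 : L →L[ℂ] L) := by
      refine Continuous.ext_on hd (R (op q)).continuous (by fun_prop) ?_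
      rintro _ ⟨b, rfl⟩
      have : R (op q) (R b Ω) = R b (R (op q) Ω) := by
        rw [← mul_apply_eq_comp, ← mul_apply_eq_comp,
          ← map_mul, ← map_mul]
        congr 2
        apply unop_injective
        simp [hq]
      simp [this, h1]
    exact DFunLike.coe_injective h2

end PartFour

section PartFive
open scoped TensorProduct

variable {G L : Type*} [NormedAddCommGroup G] [InnerProductSpace ℂ G] [CompleteSpace G]
    [NormedAddCommGroup L] [InnerProductSpace ℂ L] [CompleteSpace L]

lemma exists_slices (ζ : Completion (G ⊗[ℂ] L)) :
    ∃ (T : L →L⋆[ℂ] G) (c : G →L⋆[ℂ] L),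
      (∀ l g, inner ℂ (T l) g = inner ℂ ζ ((g ⊗ₜ[ℂ] l : G ⊗[ℂ] L) : Completion (G ⊗[ℂ] L))) ∧
      (∀ l g, inner ℂ (c g) l = inner ℂ ζ ((g ⊗ₜ[ℂ] l : G ⊗[ℂ] L) : Completion (G ⊗[ℂ] L))) := by
  let β0 : G →ₗ[ℂ] L →ₗ[ℂ] ℂ := (TensorProduct.mk ℂ G L).compr₂
    ((innerSL ℂ ζ).toLinearMap ∘ₗ
      (Completion.toComplL : (G ⊗[ℂ] L) →L[ℂ] Completion (G ⊗[ℂ] L)).toLinearMap)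
  have hβ0 : ∀ g l, β0 g l =
      inner ℂ ζ ((g ⊗ₜ[ℂ] l : G ⊗[ℂ] L) : Completion (G ⊗[ℂ] L)) := fun g l => rfl
  let β : G →L[ℂ] L →L[ℂ] ℂ := LinearMap.mkContinuous₂ β0 ‖ζ‖ (by
    intro g l
    rw [hβ0]
    refine (norm_inner_le_norm _ _).trans ?_
    rw [Completion.norm_coe, TensorProduct.norm_tmul, mul_assoc])
  have hβ : ∀ g l, β g l =
      inner ℂ ζ ((g ⊗ₜ[ℂ] l : G ⊗[ℂ] L) : Completion (G ⊗[ℂ] L)) := fun g l => rfl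
  let dG : (G →L[ℂ] ℂ) →L⋆[ℂ] G :=
    ((InnerProductSpace.toDual ℂ G).symm.toContinuousLinearEquiv : _ →L⋆[ℂ] _)
  let dL : (L →L[ℂ] ℂ) →L⋆[ℂ] L :=
    ((InnerProductSpace.toDual ℂ L).symm.toContinuousLinearEquiv : _ →L⋆[ℂ] _)
  refine ⟨dG.comp β.flip, dL.comp β, fun l g => ?_, fun l g => ?_⟩
  · rw [← hβ]
    exact InnerProductSpace.toDual_symm_apply
  · rw [← hβ]
    exact InnerProductSpace.toDual_symm_apply

lemma eq_zero_of_inner_tmul (ζ : Completion (G ⊗[ℂ] L))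
    (h : ∀ g l, inner ℂ ζ ((g ⊗ₜ[ℂ] l : G ⊗[ℂ] L) : Completion (G ⊗[ℂ] L)) = 0) : ζ = 0 := by
  have h1 : ∀ x : G ⊗[ℂ] L, inner ℂ ζ (x : Completion (G ⊗[ℂ] L)) = 0 := by
    intro x
    induction x with
    | zero => rw [Completion.coe_zero, inner_zero_right]
    | tmul g l => exact h g l
    | add x y hx hy => rw [Completion.coe_add, inner_add_right, hx, hy, add_zero]
  have h2 : ∀ y : Completion (G ⊗[ℂ] L), inner ℂ ζ y = 0 := by
    intro y
    induction y using Completion.induction_on with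
    | hp => exact isClosed_eq (by fun_prop) (by fun_prop)
    | ih x => exact h1 x
  exact inner_self_eq_zero.mp (h2 ζ)

lemma slice_compact (T : Completion (G ⊗[ℂ] L) → (L →L⋆[ℂ] G))
    (hT : ∀ ζ l g, inner ℂ (T ζ l) g =
      inner ℂ ζ ((g ⊗ₜ[ℂ] l : G ⊗[ℂ] L) : Completion (G ⊗[ℂ] L))) (ζ) :
    IsCompactOperator (T ζ) := by
  have hadd : ∀ ζ ζ', T (ζ + ζ') = T ζ + T ζ' := by
    intro ζ ζ'
    ext l
    refine ext_inner_right ℂ fun g => ?_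
    simp only [ContinuousLinearMap.add_apply, inner_add_left, hT]
  have hbd : ∀ ζ, ‖T ζ‖ ≤ ‖ζ‖ := by
    intro ζ
    refine ContinuousLinearMap.opNorm_le_bound _ (norm_nonneg _) fun l => ?_
    have h1 := hT ζ l (T ζ l)
    rw [inner_self_cplx] at h1
    have h2 : ‖T ζ l‖ ^ 2 ≤ ‖ζ‖ * (‖T ζ l‖ * ‖l‖) := by
      have := norm_inner_le_norm (𝕜 := ℂ) ζ ((T ζ l ⊗ₜ[ℂ] l : G ⊗[ℂ] L) : Completion (G ⊗[ℂ] L))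
      rw [← h1, Completion.norm_coe, TensorProduct.norm_tmul] at this
      simpa using this
    rcases eq_or_lt_of_le (norm_nonneg (T ζ l)) with h | h
    · rw [← h]; positivity
    · have : ‖T ζ l‖ * ‖T ζ l‖ ≤ ‖T ζ l‖ * (‖ζ‖ * ‖l‖) := by nlinarith
      exact le_of_mul_le_mul_left this h
  have h0 : T 0 = 0 := by simpa using hadd 0 0
  let Tm : Completion (G ⊗[ℂ] L) →+ (L →L⋆[ℂ] G) := { toFun := T, map_zero' := h0, map_add' := hadd }
  have hcont : Continuous T :=
    AddMonoidHomClass.continuous_of_bound Tm 1 (fun x => by rw [one_mul]; exact hbd x)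
  have hel : ∀ x : G ⊗[ℂ] L, IsCompactOperator (T (x : Completion (G ⊗[ℂ] L))) := by
    intro x
    induction x with
    | zero => rw [Completion.coe_zero, h0]; exact isCompactOperator_zero
    | tmul g0 l0 =>
      have e : (T ((g0 ⊗ₜ[ℂ] l0 : G ⊗[ℂ] L) : Completion (G ⊗[ℂ] L)) : L → G) =
          (fun c : ℂ => star c • g0) ∘ (innerSL ℂ l0) := by
        funext l
        refine ext_inner_right ℂ fun g => ?_
        rw [hT, Completion.inner_coe, TensorProduct.inner_tmul]
        simp [inner_smul_left, mul_comm]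
      rw [e]
      exact (isCompactOperator_of_locallyCompactSpace_dom (innerSL ℂ l0)).continuous_comp
        (by fun_prop)
    | add x y hx hy => rw [Completion.coe_add, hadd]; exact hx.add hy
  induction ζ using Completion.induction_on with
  | hp => exact isClosed_setOfPred_isCompactOperator.preimage hcont
  | ih x => exact hel x

lemma central_slice {A : Type*} [CStarAlgebra A]
    (P : A →⋆ₐ[ℂ] (G →L[ℂ] G)) (R : Aᵐᵒᵖ →⋆ₐ[ℂ] (L →L[ℂ] L))
    (PL : A →⋆ₐ[ℂ] (Completion (G ⊗[ℂ] L) →L[ℂ] Completion (G ⊗[ℂ] L)))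
    (PR : Aᵐᵒᵖ →⋆ₐ[ℂ] (Completion (G ⊗[ℂ] L) →L[ℂ] Completion (G ⊗[ℂ] L)))
    (hPL : ∀ a g l, PL a ((g ⊗ₜ[ℂ] l : G ⊗[ℂ] L) : Completion (G ⊗[ℂ] L)) =
        ((P a g ⊗ₜ[ℂ] l : G ⊗[ℂ] L) : Completion (G ⊗[ℂ] L)))
    (hPR : ∀ b g l, PR b ((g ⊗ₜ[ℂ] l : G ⊗[ℂ] L) : Completion (G ⊗[ℂ] L)) =
        ((g ⊗ₜ[ℂ] R b l : G ⊗[ℂ] L) : Completion (G ⊗[ℂ] L)))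
    (ζ : Completion (G ⊗[ℂ] L)) (hζ : ∀ a, PL a ζ = PR (op a) ζ)
    (T : L →L⋆[ℂ] G) (hT : ∀ l g, inner ℂ (T l) g =
      inner ℂ ζ ((g ⊗ₜ[ℂ] l : G ⊗[ℂ] L) : Completion (G ⊗[ℂ] L))) (a : A) (l : L) :
    P a (T l) = T (R (op (star a)) l) := by
  refine ext_inner_right ℂ fun g => ?_
  rw [inner_star_rep, hT, hT, ← hPL, ← hPR, op_star, ← inner_star_rep, hζ,
    ← inner_star_rep]

lemma exists_fd_central {A : Type*} [CStarAlgebra A]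
    (P : A →⋆ₐ[ℂ] (G →L[ℂ] G)) (R : Aᵐᵒᵖ →⋆ₐ[ℂ] (L →L[ℂ] L))
    (PL : A →⋆ₐ[ℂ] (Completion (G ⊗[ℂ] L) →L[ℂ] Completion (G ⊗[ℂ] L)))
    (PR : Aᵐᵒᵖ →⋆ₐ[ℂ] (Completion (G ⊗[ℂ] L) →L[ℂ] Completion (G ⊗[ℂ] L)))
    (hPL : ∀ a g l, PL a ((g ⊗ₜ[ℂ] l : G ⊗[ℂ] L) : Completion (G ⊗[ℂ] L)) =
        ((P a g ⊗ₜ[ℂ] l : G ⊗[ℂ] L) : Completion (G ⊗[ℂ] L)))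
    (hPR : ∀ b g l, PR b ((g ⊗ₜ[ℂ] l : G ⊗[ℂ] L) : Completion (G ⊗[ℂ] L)) =
        ((g ⊗ₜ[ℂ] R b l : G ⊗[ℂ] L) : Completion (G ⊗[ℂ] L)))
    (ζ : Completion (G ⊗[ℂ] L)) (hζ0 : ζ ≠ 0) (hζ : ∀ a, PL a ζ = PR (op a) ζ) :
    ∃ (T : L →L⋆[ℂ] G) (V : Submodule ℂ L), FiniteDimensional ℂ V ∧
      (∀ b, ∀ x ∈ V, R b x ∈ V) ∧ (∃ x ∈ V, T x ≠ 0) ∧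
      ∀ a l, P a (T l) = T (R (op (star a)) l) := by
  choose T c hT hc using fun ζ : Completion (G ⊗[ℂ] L) => exists_slices ζ
  have hTP := central_slice P R PL PR hPL hPR ζ hζ (T ζ) (hT ζ)
  let S : L →L[ℂ] L := (c ζ).comp (T ζ)
  have hS : ∀ l l', inner ℂ (S l) l' = inner ℂ (T ζ l') (T ζ l) := by
    intro l l'
    rw [hT]
    exact hc _ _ _
  have hsym : S.IsSymmetric := by
    intro l l'
    change inner ℂ (S l) l' = inner ℂ l (S l')
    rw [hS, ← inner_conj_symm l, hS, inner_conj_symm]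
  have hcomp : IsCompactOperator S := (slice_compact T hT ζ).continuous_comp (c ζ).continuous
  have hne : S ≠ 0 := by
    intro h
    apply hζ0
    apply eq_zero_of_inner_tmul
    intro g l
    have h1 := hS l l
    rw [h] at h1
    have h2 : T ζ l = 0 := by
      rw [← inner_self_eq_zero (𝕜 := ℂ), ← h1]; simp
    rw [← hT, h2, inner_zero_left]
  have hcommS : ∀ b l, S (R b l) = R b (S l) := by
    intro b l
    obtain ⟨a, rfl⟩ : ∃ a, b = op (star a) := ⟨star (unop b), by simp⟩
    refine ext_inner_right ℂ fun l' => ?_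
    rw [hS, ← hTP, inner_star_rep, hS]
    rw [← star_star a, ← inner_star_rep, hTP, star_star, op_star, star_star]
  have := (ContinuousLinearMap.eq_zero_of_forall_hasEigenvalue_eq_zero hcomp hsym).not.mpr hne
  push Not at this
  obtain ⟨μ, hμ, hμ0⟩ := this
  refine ⟨T ζ, Module.End.eigenspace S.toLinearMap μ,
    ContinuousLinearMap.finite_dimensional_eigenspace hcomp μ hμ0, ?_, ?_, hTP⟩
  · intro b x hx
    rw [Module.End.mem_eigenspace_iff] at hx ⊢
    change S x = _ at hx
    change S (R b x) = _
    rw [hcommS, hx, map_smul]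
  · obtain ⟨x, hx⟩ := hμ.exists_hasEigenvector
    refine ⟨x, hx.1, fun h => ?_⟩
    have h1 : S x = μ • x := hx.apply_eq_smul
    have h2 : S x = 0 := by
      change c ζ (T ζ x) = 0
      rw [h, map_zero]
    rw [h2] at h1
    exact (smul_ne_zero hμ0 hx.2) h1.symm

end PartFive

section PartSix

lemma exists_matrix_rep {A : Type*} [CStarAlgebra A] {G : Type*} [NormedAddCommGroup G]
    [InnerProductSpace ℂ G] [CompleteSpace G] {ι : Type*} [Fintype ι] [DecidableEq ι]
    (P : A →⋆ₐ[ℂ] (G →L[ℂ] G)) :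
    ∃ Q : Matrix ι ι A →⋆ₐ[ℂ] (PiLp 2 (fun _ : ι => G) →L[ℂ] PiLp 2 (fun _ : ι => G)),
      ∀ Y x i, Q Y x i = ∑ j, P (Y i j) (x j) := by
  let e := PiLp.continuousLinearEquiv 2 ℂ (fun _ : ι => G)
  let q : Matrix ι ι A → (PiLp 2 (fun _ : ι => G) →L[ℂ] PiLp 2 (fun _ : ι => G)) := fun Y =>
    (e.symm : (ι → G) →L[ℂ] _).comp ((ContinuousLinearMap.pi fun i =>
      ∑ j, (P (Y i j)).comp (ContinuousLinearMap.proj j)).comp (e : _ →L[ℂ] (ι → G)))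
  have hq : ∀ Y x i, q Y x i = ∑ j, P (Y i j) (x j) := by
    intro Y x i
    simp [q, e]
  refine ⟨{ toFun := q, map_one' := ?_, map_mul' := ?_,
            map_zero' := ?_, map_add' := ?_, commutes' := ?_, map_star' := ?_ }, hq⟩
  · ext x i
    rw [hq, Finset.sum_eq_single i]
    · simp
    · intro j _ hj
      simp [Matrix.one_apply_ne' hj]
    · simp
  · intro Y Z
    ext x i
    rw [hq, mul_apply_eq_comp, hq]
    simp only [hq, Matrix.mul_apply, map_sum, map_mul, ContinuousLinearMap.sum_apply,
      mul_apply_eq_comp]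
    rw [Finset.sum_comm]
  · ext x i
    rw [hq]
    simp
  · intro Y Z
    ext x i
    simp [hq, Finset.sum_add_distrib]
  · intro c
    ext x i
    rw [hq, Finset.sum_eq_single i]
    · simp [Algebra.algebraMap_eq_smul_one]
    · intro j _ hj
      simp [Algebra.algebraMap_eq_smul_one, Matrix.one_apply_ne' hj]
    · simp
  · intro Y
    refine (ContinuousLinearMap.eq_adjoint_iff _ _).mpr ?_
    intro x y
    simp only [PiLp.inner_apply, hq, sum_inner, inner_sum]
    rw [Finset.sum_comm]
    simp only [Matrix.star_apply, inner_star_rep, star_star]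

/-- Abstract spectral gap consequence of property T. -/
lemma propT_gap {A : Type*} [CStarAlgebra A] [TopologicalSpace.SeparableSpace A]
    (hT : PropertyT A) {H : Type} [NormedAddCommGroup H] [InnerProductSpace ℂ H] [CompleteSpace H]
    (L : A →⋆ₐ[ℂ] (H →L[ℂ] H)) (R : Aᵐᵒᵖ →⋆ₐ[ℂ] (H →L[ℂ] H))
    (hc : ∀ a b, Commute (L a) (R b)) (h0 : ∀ ξ, (∀ a, L a ξ = R (op a) ξ) → ξ = 0) :
    ∃ (F : Finset A) (ε : ℝ), 0 < ε ∧ ∀ x, ε * ‖x‖ ^ 2 ≤ ∑ a ∈ F, ‖L a x - R (op a) x‖ ^ 2 := by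
  classical
  by_contra hcon
  push Not at hcon
  obtain ⟨u, hu⟩ := TopologicalSpace.exists_dense_seq A
  have key : ∀ n : ℕ, ∃ x : H, ‖x‖ = 1 ∧ ∀ m ≤ n, ‖L (u m) x - R (op (u m)) x‖ ^ 2 ≤ 1 / (n + 1 : ℝ) := by
    intro n
    obtain ⟨x, hx⟩ := hcon ((Finset.range (n + 1)).image u) (1 / (n + 1 : ℝ)) (by positivity)
    have hx0 : 0 < ‖x‖ := by
      rcases eq_or_lt_of_le (norm_nonneg x) with h | h
      · have hx' : x = 0 := by simpa using h.symm
        simp [hx'] at hx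
      · exact h
    refine ⟨((‖x‖⁻¹ : ℝ) : ℂ) • x, ?_, ?_⟩
    · rw [norm_smul]
      simp [hx0.ne']
    · intro m hm
      rw [map_smul, map_smul, ← smul_sub, norm_smul, mul_pow]
      have h1 : ‖L (u m) x - R (op (u m)) x‖ ^ 2 ≤
          ∑ a ∈ (Finset.range (n + 1)).image u, ‖L a x - R (op a) x‖ ^ 2 :=
        Finset.single_le_sum (f := fun a => ‖L a x - R (op a) x‖ ^ 2) (fun _ _ => by positivity)
          (Finset.mem_image_of_mem _ (Finset.mem_range.mpr (by omega)))
      have h2 : ‖((‖x‖⁻¹ : ℝ) : ℂ)‖ = ‖x‖⁻¹ := by simp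
      rw [h2, inv_pow, inv_mul_le_iff₀ (by positivity)]
      linarith
  choose ξ hξ1 hξ2 using key
  have hlimu : ∀ m, Tendsto (fun n => ‖L (u m) (ξ n) - R (op (u m)) (ξ n)‖) atTop (nhds 0) := by
    intro m
    have h1 : Tendsto (fun n => ‖L (u m) (ξ n) - R (op (u m)) (ξ n)‖ ^ 2) atTop (nhds 0) := by
      refine squeeze_zero' (Eventually.of_forall fun n => by positivity) ?_
        tendsto_one_div_add_atTop_nhds_zero_nat
      filter_upwards [eventually_ge_atTop m] with n hn
      exact hξ2 n m hn
    have h2 := (Real.continuous_sqrt.tendsto _).comp h1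
    simp only [Function.comp_def, Real.sqrt_zero] at h2
    exact h2.congr fun n => Real.sqrt_sq (norm_nonneg _)
  obtain ⟨ζ, hζ0, hζ⟩ := hT H L R hc ⟨ξ, hξ1, by
    intro a
    rw [Metric.tendsto_atTop]
    intro ε hε
    obtain ⟨m, hm⟩ := hu.exists_dist_lt a (show 0 < ε / 4 by positivity)
    obtain ⟨N, hN⟩ := Metric.tendsto_atTop.mp (hlimu m) (ε / 2) (by positivity)
    refine ⟨N, fun n hn => ?_⟩
    have h1 := hN n hn
    rw [dist_zero_right, norm_norm] at h1 ⊢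
    have e : L a (ξ n) - R (op a) (ξ n) = (L (u m) (ξ n) - R (op (u m)) (ξ n)) +
        L (a - u m) (ξ n) - R (op (a - u m)) (ξ n) := by
      simp only [map_sub, op_sub, ContinuousLinearMap.sub_apply]
      abel
    have b1 : ‖L (a - u m) (ξ n)‖ ≤ ε / 4 := by
      refine ((L (a - u m)).le_opNorm _).trans ?_
      rw [hξ1, mul_one]
      refine (NonUnitalStarAlgHom.norm_apply_le L _).trans ?_
      rw [← dist_eq_norm]; exact hm.le
    have b2 : ‖R (op (a - u m)) (ξ n)‖ ≤ ε / 4 := by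
      refine ((R _).le_opNorm _).trans ?_
      rw [hξ1, mul_one]
      refine (NonUnitalStarAlgHom.norm_apply_le R _).trans ?_
      rw [MulOpposite.norm_op, ← dist_eq_norm]; exact hm.le
    rw [e]
    have t1 := norm_sub_le (L (u m) (ξ n) - R (op (u m)) (ξ n) + L (a - u m) (ξ n))
      (R (op (a - u m)) (ξ n))
    have t2 := norm_add_le (L (u m) (ξ n) - R (op (u m)) (ξ n)) (L (a - u m) (ξ n))
    linarith⟩
  exact hζ0 (h0 ζ hζ)

/-- A coercive operator has a contractive perturbation of the identity. -/
lemma contraction_of_gap {H : Type*} [NormedAddCommGroup H] [InnerProductSpace ℂ H]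
    (D : H →L[ℂ] H) (ε : ℝ) (hε : 0 < ε) (hD : ∀ x, ε * ‖x‖ ^ 2 ≤ (inner ℂ x (D x)).re) :
    ∃ c κ : ℝ, 0 ≤ κ ∧ κ < 1 ∧ ‖(1 : H →L[ℂ] H) - (c : ℂ) • D‖ ≤ κ := by
  set C := ‖D‖
  set c := C ^ 2 / ε + ε with hc
  have hc0 : 0 < c := by positivity
  have hcε : ε ≤ c := by
    have : 0 ≤ C ^ 2 / ε := by positivity
    linarith
  have hC : C ^ 2 ≤ c * ε := by
    rw [hc, add_mul, div_mul_cancel₀ _ hε.ne']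
    nlinarith
  have hle : ε / c ≤ 1 := by rw [div_le_one hc0]; exact hcε
  refine ⟨c⁻¹, Real.sqrt (1 - ε / c), Real.sqrt_nonneg _, ?_, ?_⟩
  · rw [Real.sqrt_lt' one_pos]
    have : 0 < ε / c := by positivity
    linarith
  · refine ContinuousLinearMap.opNorm_le_bound _ (Real.sqrt_nonneg _) fun x => ?_
    refine le_of_sq_le_sq ?_ (by positivity)
    rw [mul_pow, Real.sq_sqrt (by linarith)]
    have e1 : ((1 : H →L[ℂ] H) - ((c⁻¹ : ℝ) : ℂ) • D) x = x - ((c⁻¹ : ℝ) : ℂ) • D x := by simp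
    rw [e1, @norm_sub_sq ℂ, inner_smul_right, norm_smul]
    have e2 : RCLike.re (((c⁻¹ : ℝ) : ℂ) * inner ℂ x (D x)) = c⁻¹ * (inner ℂ x (D x)).re := by
      simp [RCLike.re_to_complex, Complex.re_ofReal_mul]
    have e3 : ‖((c⁻¹ : ℝ) : ℂ)‖ = c⁻¹ := by
      rw [Complex.norm_real, Real.norm_of_nonneg (by positivity)]
    rw [e2, e3, mul_pow]
    have h1 : ‖D x‖ ^ 2 ≤ c * ε * ‖x‖ ^ 2 := by
      calc ‖D x‖ ^ 2 ≤ (C * ‖x‖) ^ 2 := by gcongr; exact D.le_opNorm x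
        _ = C ^ 2 * ‖x‖ ^ 2 := by ring
        _ ≤ _ := by gcongr
    have h2 : c⁻¹ ^ 2 * ‖D x‖ ^ 2 ≤ (ε / c) * ‖x‖ ^ 2 := by
      calc c⁻¹ ^ 2 * ‖D x‖ ^ 2 ≤ c⁻¹ ^ 2 * (c * ε * ‖x‖ ^ 2) := by gcongr
        _ = _ := by field_simp
    have h3 : (ε / c) * ‖x‖ ^ 2 ≤ c⁻¹ * (inner ℂ x (D x)).re := by
      calc (ε / c) * ‖x‖ ^ 2 = c⁻¹ * (ε * ‖x‖ ^ 2) := by field_simp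
        _ ≤ _ := by gcongr; exact hD x
    nlinarith

/-- restriction of a representation to an invariant subspace -/
lemma exists_subrep {B : Type*} [CStarAlgebra B] {H : Type*} [NormedAddCommGroup H]
    [InnerProductSpace ℂ H] [CompleteSpace H] (P : B →⋆ₐ[ℂ] (H →L[ℂ] H)) (V : Submodule ℂ H)
    [CompleteSpace V] (hV : ∀ b, ∀ x ∈ V, P b x ∈ V) :
    ∃ σ : B →⋆ₐ[ℂ] (V →L[ℂ] V), ∀ b (x : V), ((σ b x : V) : H) = P b x := by
  let q : B → (V →L[ℂ] V) := fun b => ((P b).comp V.subtypeL).codRestrict V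
    (fun x => hV b x x.2)
  have hq : ∀ b (x : V), ((q b x : V) : H) = P b x := fun b x => rfl
  refine ⟨{ toFun := q, map_one' := ?_, map_mul' := ?_,
            map_zero' := ?_, map_add' := ?_, commutes' := ?_, map_star' := ?_ }, hq⟩
  · ext x; rw [hq]; simp
  · intro a b
    ext x
    rw [hq, mul_apply_eq_comp, hq, hq, map_mul, mul_apply_eq_comp]
  · ext x; rw [hq]; simp
  · intro a b
    ext x
    simp [hq]
  · intro c
    ext x
    rw [hq]
    simp [Algebra.algebraMap_eq_smul_one]
  · intro a
    refine (ContinuousLinearMap.eq_adjoint_iff _ _).mpr ?_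
    intro x y
    simp only [Submodule.coe_inner, hq]
    rw [inner_star_rep, star_star]

end PartSix

section PartSeven

/-- scalar matrices -/
noncomputable def scalarHom (ι A : Type*) [Fintype ι] [DecidableEq ι] [CStarAlgebra A] :
    A →⋆ₐ[ℂ] Matrix ι ι A where
  toFun a := Matrix.diagonal fun _ => a
  map_one' := by simp
  map_mul' a b := by simp
  map_zero' := by simp
  map_add' a b := by simp
  commutes' c := by ext i j; simp [Matrix.diagonal_apply, Matrix.algebraMap_matrix_apply]
  map_star' a := by
    rw [Matrix.star_eq_conjTranspose, Matrix.diagonal_conjTranspose]; rfl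

/-- complex matrices inside matrices over `A` -/
noncomputable def constHom (ι A : Type*) [Fintype ι] [DecidableEq ι] [CStarAlgebra A] :
    Matrix ι ι ℂ →⋆ₐ[ℂ] Matrix ι ι A where
  toFun M := M.map (algebraMap ℂ A)
  map_one' := by simp
  map_mul' a b := by rw [Matrix.map_mul]
  map_zero' := by simp
  map_add' a b := by ext i j; simp
  commutes' c := by
    ext i j
    by_cases h : i = j <;> simp [Matrix.algebraMap_matrix_apply, h]
  map_star' a := by
    ext i j
    exact algebraMap_star_comm _

lemma kazhdan_core {A : Type} [CStarAlgebra A] [TopologicalSpace.SeparableSpace A]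
    (hT : PropertyT A) {G : Type} [NormedAddCommGroup G] [InnerProductSpace ℂ G] [CompleteSpace G]
    {N : Type} [NormedAddCommGroup N] [InnerProductSpace ℂ N] [CompleteSpace N]
    (P : A →⋆ₐ[ℂ] (G →L[ℂ] G)) (σ : A →⋆ₐ[ℂ] (N →L[ℂ] N)) (hinj : Function.Injective σ)
    {ι : Type} [Fintype ι] [DecidableEq ι] (r : Aᵐᵒᵖ →⋆ₐ[ℂ] Matrix ι ι ℂ) (g : ι → G)
    (hPg : ∀ a i, P a (g i) = ∑ j, r (op a) i j • g j)
    (hN : ∀ x, (∀ k, r (op k) = 0 → σ k x = 0) → x = 0) : g = 0 := by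
  obtain ⟨Q, hQ⟩ := exists_matrix_rep (ι := ι) σ
  obtain ⟨Q', hQ'⟩ := exists_matrix_rep (ι := ι) P
  let lam := scalarHom ι A
  let rho := (constHom ι A).comp r
  have hlam : ∀ a i j, lam a i j = if i = j then a else 0 := fun a i j =>
    Matrix.diagonal_apply _ _ _
  have hrho : ∀ b i j, rho b i j = algebraMap ℂ A (r b i j) := fun b i j => rfl
  have hcomm : ∀ a b, lam a * rho b = rho b * lam a := by
    intro a b
    ext i j
    simp only [Matrix.mul_apply, hlam, hrho, ite_mul, mul_ite, zero_mul, mul_zero]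
    simp [Algebra.commutes]
  have hLapp : ∀ a x i, Q (lam a) x i = σ a (x i) := by
    intro a x i
    rw [hQ, Finset.sum_eq_single i]
    · simp [hlam]
    · intro j _ hj
      simp [hlam, hj.symm]
    · simp
  have hRapp : ∀ b x i, Q (rho b) x i = ∑ j, r b i j • x j := by
    intro b x i
    simp [hQ, hrho, Algebra.algebraMap_eq_smul_one]
  obtain ⟨F, ε, hε, hgap⟩ := propT_gap hT (Q.comp lam) (Q.comp rho) (by
    intro a b
    change Q (lam a) * Q (rho b) = Q (rho b) * Q (lam a)
    rw [← map_mul, ← map_mul, hcomm]) (by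
    intro x hx
    ext i
    refine hN (x i) fun k hk => ?_
    have h1 : Q (lam k) x i = Q (rho (op k)) x i := by
      have := hx k
      exact congrArg (fun y => (y : PiLp 2 _) i) this
    rw [hLapp, hRapp, hk] at h1
    rw [h1]
    simp)
  let d : A → Matrix ι ι A := fun a => lam a - rho (op a)
  let D : Matrix ι ι A := ∑ a ∈ F, star (d a) * d a
  obtain ⟨c, κ, hκ0, hκ1, hX⟩ := contraction_of_gap (Q D) ε hε (by
    intro x
    refine (hgap x).trans (le_of_eq ?_)
    have e : ∀ a, (inner ℂ x (Q (star (d a) * d a) x)).re = ‖Q (d a) x‖ ^ 2 := by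
      intro a
      rw [map_mul, mul_apply_eq_comp, map_star, ContinuousLinearMap.star_eq_adjoint, ContinuousLinearMap.adjoint_inner_right, inner_self_cplx, Complex.ofReal_re]
    simp only [D, map_sum, ContinuousLinearMap.sum_apply, inner_sum, Complex.re_sum, e]
    refine Finset.sum_congr rfl fun a _ => ?_
    simp only [d, map_sub, ContinuousLinearMap.sub_apply]
    rfl)
  let X : Matrix ι ι A := 1 - (c : ℂ) • D
  have hQX : ‖Q X‖ ≤ κ := by
    have : Q X = 1 - (c : ℂ) • Q D := by simp only [X, map_sub, map_one, map_smul]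
    rw [this]; exact hX
  have hQXk : ∀ k : ℕ, ‖Q (X ^ k)‖ ≤ κ ^ k := by
    intro k
    rw [map_pow]
    induction k with
    | zero =>
      rw [pow_zero, pow_zero]
      exact ContinuousLinearMap.norm_id_le
    | succ k ih =>
      rw [pow_succ, pow_succ]
      exact (norm_mul_le _ _).trans (by gcongr)
  have hent : ∀ (Y : Matrix ι ι A) i j, ‖Y i j‖ ≤ ‖Q Y‖ := by
    intro Y i j
    rw [← NonUnitalStarAlgHom.norm_map σ hinj]
    refine ContinuousLinearMap.opNorm_le_bound _ (norm_nonneg _) fun y => ?_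
    have e : σ (Y i j) y = Q Y (PiLp.single 2 j y) i := by
      rw [hQ, Finset.sum_eq_single j]
      · simp
      · intro b _ hb
        simp [hb]
      · simp
    rw [e]
    refine (PiLp.norm_apply_le (p := 2) (β := fun _ : ι => N) (Q Y (PiLp.single 2 j y)) i).trans ?_
    refine ((Q Y).le_opNorm _).trans (le_of_eq ?_)
    rw [PiLp.norm_single]
  let ζ : PiLp 2 (fun _ : ι => G) := WithLp.toLp 2 g
  have hdζ : ∀ a, Q' (d a) ζ = 0 := by
    intro a
    ext i
    rw [hQ']
    simp only [d, Matrix.sub_apply, map_sub, ContinuousLinearMap.sub_apply,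
      Finset.sum_sub_distrib, hrho, Algebra.algebraMap_eq_smul_one, map_smul, map_one]
    rw [Finset.sum_eq_single i]
    · simp [hlam, ζ, hPg]
    · intro j _ hj
      simp [hlam, hj.symm]
    · simp
  have hXζ : Q' X ζ = ζ := by
    simp only [X, D, map_sub, map_one, map_smul, map_sum, map_mul, ContinuousLinearMap.sub_apply,
      ContinuousLinearMap.smul_apply, ContinuousLinearMap.sum_apply, mul_apply_eq_comp, hdζ]
    simp
  have hXkζ : ∀ k : ℕ, Q' (X ^ k) ζ = ζ := by
    intro k
    induction k with
    | zero => simp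
    | succ k ih => rw [pow_succ, map_mul, mul_apply_eq_comp, hXζ, ih]
  funext i
  have hbound : ∀ k : ℕ, ‖g i‖ ≤ κ ^ k * ∑ j, ‖g j‖ := by
    intro k
    have h1 : g i = ∑ j, P ((X ^ k) i j) (g j) := by
      have := congrArg (fun y => (y : PiLp 2 (fun _ : ι => G)) i) (hXkζ k)
      simp only [hQ'] at this
      exact this.symm
    rw [h1, Finset.mul_sum]
    refine (norm_sum_le _ _).trans (Finset.sum_le_sum fun j _ => ?_)
    refine ((P _).le_opNorm _).trans ?_
    gcongr
    exact (NonUnitalStarAlgHom.norm_apply_le P _).trans ((hent _ _ _).trans (hQXk k))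
  have hlim : Tendsto (fun k : ℕ => κ ^ k * ∑ j, ‖g j‖) atTop (nhds 0) := by
    simpa using (tendsto_pow_atTop_nhds_zero_of_lt_one hκ0 hκ1).mul_const (∑ j, ‖g j‖)
  have := ge_of_tendsto' hlim hbound
  simpa using le_antisymm this (norm_nonneg _)

lemma kazhdan {A : Type} [CStarAlgebra A] [TopologicalSpace.SeparableSpace A]
    (hT : PropertyT A) {G : Type} [NormedAddCommGroup G] [InnerProductSpace ℂ G] [CompleteSpace G]
    (P : A →⋆ₐ[ℂ] (G →L[ℂ] G)) (hP : ∀ a, P a = 0 → a = 0)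
    {ι : Type} [Fintype ι] [DecidableEq ι] (r : Aᵐᵒᵖ →⋆ₐ[ℂ] Matrix ι ι ℂ) (g : ι → G)
    (hg : g ≠ 0) (hPg : ∀ a i, P a (g i) = ∑ j, r (op a) i j • g j) :
    ∃ I : Submodule ℂ A, I ≠ ⊥ ∧ (∀ a, ∀ x ∈ I, a * x ∈ I) ∧ (∀ a, ∀ x ∈ I, x * a ∈ I) ∧
      (∀ x ∈ I, star x ∈ I) ∧ ∀ x ∈ I, r (op x) = 0 → x = 0 := by
  let M : Submodule ℂ G :=
    { carrier := {x | ∀ k, r (op k) = 0 → P k x = 0}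
      add_mem' := fun {x y} hx hy k hk => by rw [map_add, hx k hk, hy k hk, add_zero]
      zero_mem' := fun k _ => map_zero _
      smul_mem' := fun c x hx k hk => by rw [map_smul, hx k hk, smul_zero] }
  have hMmem : ∀ x, x ∈ M ↔ ∀ k, r (op k) = 0 → P k x = 0 := fun x => Iff.rfl
  have hMclosed : IsClosed (M : Set G) := by
    have : (M : Set G) = ⋂ k, ⋂ (_ : r (op k) = 0), {x | P k x = 0} := by
      ext x
      simp [hMmem]
    rw [this]
    exact isClosed_iInter fun k => isClosed_iInter fun _ =>
      isClosed_eq (P k).continuous continuous_const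
  have hMc : CompleteSpace M := hMclosed.completeSpace_coe
  have hMinv : ∀ a, ∀ x ∈ M, P a x ∈ M := by
    intro a x hx k hk
    rw [← mul_apply_eq_comp, ← map_mul]
    apply hx
    rw [op_mul, map_mul, hk, mul_zero]
  have hMoinv : ∀ a, ∀ x ∈ Mᗮ, P a x ∈ Mᗮ := by
    intro a x hx
    rw [Submodule.mem_orthogonal] at hx ⊢
    intro u hu
    rw [← star_star a, ← inner_star_rep]
    exact hx _ (hMinv _ _ hu)
  obtain ⟨σ, hσ⟩ := exists_subrep P Mᗮ hMoinv
  let I : Submodule ℂ A := LinearMap.ker (σ : A →ₗ[ℂ] (Mᗮ →L[ℂ] Mᗮ))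
  have hI : ∀ x, x ∈ I ↔ σ x = 0 := fun x => Iff.rfl
  refine ⟨I, ?_, ?_, ?_, ?_, ?_⟩
  · intro hbot
    have hinj : Function.Injective σ := by
      rw [injective_iff_map_eq_zero]
      intro a ha
      have : a ∈ I := (hI a).mpr ha
      rw [hbot] at this
      simpa using this
    refine hg (kazhdan_core hT P σ hinj r g hPg ?_)
    intro x hx
    have hxM : (x : G) ∈ M := by
      intro k hk
      rw [← hσ, hx k hk]
      simp
    have h2 : inner ℂ (x : G) (x : G) = 0 :=
      (Submodule.mem_orthogonal _ _).mp x.2 _ hxM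
    simpa using h2
  · intro a x hx
    rw [hI] at hx ⊢
    rw [map_mul, hx, mul_zero]
  · intro a x hx
    rw [hI] at hx ⊢
    rw [map_mul, hx, zero_mul]
  · intro x hx
    rw [hI] at hx ⊢
    rw [map_star, hx]
    exact star_zero (Mᗮ →L[ℂ] Mᗮ)
  · intro x hx hr
    apply hP
    ext y
    obtain ⟨m, hm, m', hm', rfl⟩ := Submodule.exists_add_mem_mem_orthogonal (K := M) y
    have h1 : P x m = 0 := hm x hr
    have h2 : P x m' = 0 := by
      have := hσ x ⟨m', hm'⟩
      rw [(hI x).mp hx] at this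
      simpa using this.symm
    simp [h1, h2]

end PartSeven

lemma unit_of_fd_ideal {A : Type*} [CStarAlgebra A] (I : Submodule ℂ A) [FiniteDimensional ℂ I]
    (hI0 : I ≠ ⊥) (hl : ∀ a, ∀ x ∈ I, a * x ∈ I) (hr : ∀ a, ∀ x ∈ I, x * a ∈ I)
    (hs : ∀ x ∈ I, star x ∈ I) :
    ∃ p ∈ I, p ≠ 0 ∧ (∀ a, p * a = a * p) ∧ p * p = p ∧ star p = p ∧
      FiniteDimensional ℂ (LinearMap.range (LinearMap.mulLeft ℂ p)) := by
  let b := Module.finBasis ℂ I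
  let h : A := ∑ i, star (b i : A) * (b i : A)
  have hI : h ∈ I := Submodule.sum_mem _ fun i _ => hl _ _ (b i).2
  have hsa : IsSelfAdjoint h := by
    rw [isSelfAdjoint_iff]
    simp [h, star_sum]
  have hn : IsStarNormal h := hsa.isStarNormal
  let F : Polynomial ℂ →ₗ[ℂ] I :=
    { toFun := fun q => ⟨Polynomial.aeval h q * h, hl _ _ hI⟩
      map_add' := fun x y => by ext; simp [add_mul]
      map_smul' := fun c x => by ext; simp }
  have hF : ¬ Function.Injective F := by
    intro hinj
    exact Polynomial.not_finite (R := ℂ) (Module.Finite.of_injective F hinj)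
  obtain ⟨q, hq0, hq⟩ : ∃ q : Polynomial ℂ, q ≠ 0 ∧ Polynomial.aeval h q * h = 0 := by
    rw [← LinearMap.ker_eq_bot, Submodule.eq_bot_iff] at hF
    push Not at hF
    obtain ⟨q, h1, h2⟩ := hF
    exact ⟨q, h2, congrArg Subtype.val (LinearMap.mem_ker.1 h1)⟩
  have hfin : (spectrum ℂ h).Finite := by
    have hne : q * Polynomial.X ≠ 0 := mul_ne_zero hq0 Polynomial.X_ne_zero
    refine (Polynomial.finite_setOf_isRoot hne).subset ?_
    intro x hx
    have h1 := spectrum.subset_polynomial_aeval h (q * Polynomial.X) ⟨x, hx, rfl⟩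
    have h2 : Polynomial.aeval h (q * Polynomial.X) = 0 := by simpa using hq
    rw [h2] at h1
    by_cases hnt : Nontrivial A
    · rw [spectrum.zero_eq] at h1
      exact h1
    · rw [not_nontrivial_iff_subsingleton] at hnt
      have := spectrum.of_subsingleton (R := ℂ) h
      rw [this] at hx
      exact hx.elim
  have hc : ∀ f : ℂ → ℂ, ContinuousOn f (spectrum ℂ h) := fun f => by
    exact hfin.continuousOn f
  let p : A := cfc (fun x : ℂ => x * x⁻¹) h
  have hp1 : p = h * cfc (fun x : ℂ => x⁻¹) h := by
    have := cfc_mul (fun x : ℂ => x) (fun x : ℂ => x⁻¹) h (hc _) (hc _)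
    rw [cfc_id' ℂ h] at this
    exact this
  have hpI : p ∈ I := by rw [hp1]; exact hr _ _ hI
  have hpp : p * p = p := by
    have := cfc_mul (fun x : ℂ => x * x⁻¹) (fun x : ℂ => x * x⁻¹) h (hc _) (hc _)
    refine this.symm.trans ?_
    show _ = cfc (fun x : ℂ => x * x⁻¹) h
    congr 1
    ext x
    by_cases hx : x = 0 <;> simp [hx]
  have hps : star p = p := by
    have := cfc_star (fun x : ℂ => x * x⁻¹) h
    refine this.symm.trans ?_
    show _ = cfc (fun x : ℂ => x * x⁻¹) h
    congr 1
    ext x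
    by_cases hx : x = 0 <;> simp [hx]
  have hph : h * p = h := by
    have := cfc_mul (fun x : ℂ => x) (fun x : ℂ => x * x⁻¹) h (hc _) (hc _)
    rw [cfc_id' ℂ h] at this
    refine this.symm.trans ?_
    conv_rhs => rw [← cfc_id' ℂ h]
    congr 1
    ext x
    by_cases hx : x = 0 <;> simp [hx]
  have hbp : ∀ i, (b i : A) * (1 - p) = 0 := by
    let _ : PartialOrder A := CStarAlgebra.spectralOrder A
    let _ : StarOrderedRing A := CStarAlgebra.spectralOrderedRing A
    have h0 : ∑ i, star ((b i : A) * (1 - p)) * ((b i : A) * (1 - p)) = 0 := by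
      have : star (1 - p) * h * (1 - p) = 0 := by
        rw [mul_assoc, mul_sub, mul_one, hph, sub_self, mul_zero]
      rw [← this, Finset.mul_sum, Finset.sum_mul]
      refine Finset.sum_congr rfl fun i _ => ?_
      simp only [star_mul, mul_assoc]
    intro i
    have := (Finset.sum_eq_zero_iff_of_nonneg (fun i _ => star_mul_self_nonneg _)).1 h0 i
      (Finset.mem_univ i)
    exact CStarRing.star_mul_self_eq_zero_iff _ |>.1 this
  have hxp : ∀ x ∈ I, x * p = x := by
    intro x hx
    have : x * (1 - p) = 0 := by
      have h1 := b.sum_repr ⟨x, hx⟩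
      have h2 := congrArg Subtype.val h1
      simp only [AddSubmonoidClass.coe_finset_sum, Submodule.coe_smul] at h2
      rw [← h2, Finset.sum_mul]
      exact Finset.sum_eq_zero fun i _ => by rw [smul_mul_assoc, hbp, smul_zero]
    rw [mul_sub, mul_one, sub_eq_zero] at this
    exact this.symm
  have hpx : ∀ x ∈ I, p * x = x := by
    intro x hx
    have := congrArg star (hxp _ (hs x hx))
    simpa [hps] using this
  refine ⟨p, hpI, ?_, ?_, hpp, hps, ?_⟩
  · intro h0
    apply hI0
    rw [Submodule.eq_bot_iff]
    intro x hx
    rw [← hxp x hx, h0, mul_zero]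
  · intro a
    rw [← hxp _ (hr a p hpI), ← hpx _ (hl a p hpI), mul_assoc]
  · refine Submodule.finiteDimensional_of_le (S₂ := I) ?_
    rintro _ ⟨x, rfl⟩
    exact hr _ _ hpI

lemma matrix_of_rep {B : Type*} [CStarAlgebra B] {V : Type*} [NormedAddCommGroup V]
    [InnerProductSpace ℂ V] [CompleteSpace V] (σ : B →⋆ₐ[ℂ] (V →L[ℂ] V)) {ι : Type*} [Fintype ι]
    [DecidableEq ι] (e : OrthonormalBasis ι ℂ V) :
    ∃ r : B →⋆ₐ[ℂ] Matrix ι ι ℂ, ∀ b i j, r b i j = inner ℂ (e i) (σ b (e j)) := by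
  let q : B → Matrix ι ι ℂ := fun b => Matrix.of fun i j => inner ℂ (e i) (σ b (e j))
  have hq : ∀ b i j, q b i j = inner ℂ (e i) (σ b (e j)) := fun b i j => rfl
  have hone : ∀ i j, inner ℂ (e i) (e j) = (1 : Matrix ι ι ℂ) i j := by
    intro i j
    rw [orthonormal_iff_ite.1 e.orthonormal, Matrix.one_apply]
  refine ⟨{ toFun := q, map_one' := ?_, map_mul' := ?_,
            map_zero' := ?_, map_add' := ?_, commutes' := ?_, map_star' := ?_ }, hq⟩
  · ext i j
    rw [hq, map_one, one_apply_eq_self, hone]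
  · intro a b
    ext i j
    rw [hq, Matrix.mul_apply, map_mul, mul_apply_eq_comp]
    simp only [hq]
    have := e.sum_inner_mul_inner (σ (star a) (e i)) (σ b (e j))
    rw [inner_star_rep, star_star] at this
    rw [← this]
    refine Finset.sum_congr rfl fun k _ => ?_
    rw [inner_star_rep, star_star]
  · ext i j
    rw [hq, map_zero]; simp
  · intro a b
    ext i j
    rw [Matrix.add_apply, hq, hq, hq, map_add, ContinuousLinearMap.add_apply, inner_add_right]
  · intro c
    ext i j
    rw [hq, Algebra.algebraMap_eq_smul_one, map_smul, map_one, ContinuousLinearMap.smul_apply,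
      one_apply_eq_self, inner_smul_right, hone, Algebra.algebraMap_eq_smul_one, Matrix.smul_apply,
      smul_eq_mul]
  · intro a
    ext i j
    rw [hq, Matrix.star_apply, hq, ← inner_star_rep, ← inner_conj_symm]
    rfl

/-- `p` is a central projection with finite dimensional corner. -/
def FdProj {A : Type*} [CStarAlgebra A] (p : A) : Prop :=
  (∀ a : A, p * a = a * p) ∧ p * p = p ∧ star p = p ∧
      FiniteDimensional ℂ (LinearMap.range (LinearMap.mulLeft ℂ p))

lemma no_trace {A : Type} [CStarAlgebra A] [TopologicalSpace.SeparableSpace A]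
    (hnuc : IsNuclear A) (hT : PropertyT A)
    (τ : A →ₗ[ℂ] ℂ) (hτ : IsTracialState τ) (h0 : ∀ q, FdProj q → τ q = 0) : False := by
  obtain ⟨G, _, _, _, P, L, _, _, _, R, PL, PR, ζ, hP, hR, hPL, hPR, hζ0, hζ⟩ :=
    exists_central hnuc hT τ hτ
  obtain ⟨T, V, hVfd, hV, ⟨x0, hx0, hTx0⟩, hPT⟩ := exists_fd_central P R PL PR hPL hPR ζ hζ0 hζ
  have : CompleteSpace V := FiniteDimensional.complete ℂ V
  obtain ⟨σ, hσ⟩ := exists_subrep R V hV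
  let e := stdOrthonormalBasis ℂ V
  obtain ⟨r, hr⟩ := matrix_of_rep σ e
  have hexp : ∀ x : V, T (x : L) = ∑ j, starRingEnd ℂ (inner ℂ (e j) x) • T (e j : L) := by
    intro x
    have h1 := congrArg Subtype.val (e.sum_repr' x)
    simp only [AddSubmonoidClass.coe_finset_sum, Submodule.coe_smul] at h1
    conv_lhs => rw [← h1]
    rw [map_sum]
    refine Finset.sum_congr rfl fun j _ => ?_
    exact T.map_smulₛₗ _ _
  obtain ⟨I, hI0, hIl, hIr, hIs, hIinj⟩ := kazhdan hT P hP r (fun i => T (e i : L))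
    (by
      intro h
      apply hTx0
      rw [hexp ⟨x0, hx0⟩]
      exact Finset.sum_eq_zero fun j _ => by rw [congrFun h j]; simp)
    (by
      intro a i
      rw [hPT, ← hσ, hexp]
      refine Finset.sum_congr rfl fun j _ => ?_
      congr 1
      rw [hr, inner_conj_symm, inner_star_rep, op_star, star_star])
  have hfd : FiniteDimensional ℂ I := by
    let f : I →ₗ[ℂ] Matrix _ _ ℂ :=
      (r.toAlgHom.toLinearMap ∘ₗ (MulOpposite.opLinearEquiv ℂ : A ≃ₗ[ℂ] Aᵐᵒᵖ).toLinearMap) ∘ₗ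
        I.subtype
    have hf : Function.Injective f := by
      rw [← LinearMap.ker_eq_bot, Submodule.eq_bot_iff]
      intro x hx
      exact Subtype.ext (hIinj x x.2 hx)
    exact Module.Finite.of_injective f hf
  obtain ⟨p, hpI, hp0, hpc, hpp, hps, hpf⟩ := unit_of_fd_ideal I hI0 hIl hIr hIs
  have hτp := h0 p ⟨hpc, hpp, hps, hpf⟩
  have hRp := hR p hpc hps hpp hτp
  refine hp0 (hIinj p hpI ?_)
  ext i j
  rw [hr]
  have : σ (op p) (e j) = 0 := by
    apply Subtype.ext
    rw [hσ, hRp]; rfl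
  rw [this]; simp

lemma FdProj.sup {A : Type*} [CStarAlgebra A] {p q : A} (hp : FdProj p) (hq : FdProj q) :
    FdProj (p + q - p * q) := by
  obtain ⟨hpc, hpp, hps, hpf⟩ := hp
  obtain ⟨hqc, hqq, hqs, hqf⟩ := hq
  refine ⟨fun a => ?_, ?_, ?_, ?_⟩
  · have : p * q * a = a * (p * q) := by rw [mul_assoc, hqc, ← mul_assoc, hpc, mul_assoc]
    rw [sub_mul, add_mul, this, hpc, hqc, mul_sub, mul_add]
  · have h1 : p * (p + q - p * q) = p := by
      rw [mul_sub, mul_add, ← mul_assoc, hpp]; abel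
    have h2 : q * (p + q - p * q) = q := by
      rw [mul_sub, mul_add, ← mul_assoc, ← hpc q, mul_assoc, hqq]; abel
    rw [sub_mul, add_mul, h1, h2, mul_assoc, h2]
  · rw [star_sub, star_add, star_mul, hps, hqs, hpc]
  · refine Submodule.finiteDimensional_of_le
      (S₂ := LinearMap.range (LinearMap.mulLeft ℂ p) ⊔ LinearMap.range (LinearMap.mulLeft ℂ q)) ?_
    rintro _ ⟨x, rfl⟩
    refine Submodule.mem_sup.2 ⟨p * (x - q * x), ⟨_, rfl⟩, q * x, ⟨_, rfl⟩, ?_⟩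
    simp only [LinearMap.mulLeft_apply, sub_mul, add_mul, mul_sub, mul_assoc]
    abel

lemma main_cstar {A : Type} [CStarAlgebra A] [TopologicalSpace.SeparableSpace A]
    (hnuc : IsNuclear A) (hT : PropertyT A) :
    ∃ p : A, FdProj p ∧
      ¬∃ τ : A →ₗ[ℂ] ℂ, (∀ a : A, 0 ≤ τ (star a * a)) ∧
        (∀ a b : A, τ (a * b) = τ (b * a)) ∧ τ 1 = 1 ∧ τ p = 0 := by
  by_contra hcon
  push Not at hcon
  let X := {p : A // FdProj p}
  choose t htpos htt ht1 ht0 using fun p : X => hcon p.1 p.2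
  let S : X → Set X := fun q => {p | q.1 * p.1 = q.1}
  have hX : Nonempty X := ⟨⟨0, fun a => by simp, by simp, by simp, by
    refine Submodule.finiteDimensional_of_le (S₂ := ⊥) ?_
    rintro _ ⟨x, rfl⟩
    simp⟩⟩
  have hdir : Directed (· ≥ ·) (fun q => 𝓟 (S q)) := by
    intro p q
    refine ⟨⟨_, p.2.sup q.2⟩, ?_, ?_⟩
    · refine Filter.principal_mono.2 ?_
      intro s hs
      have hs : (p.1 + q.1 - p.1 * q.1) * s.1 = p.1 + q.1 - p.1 * q.1 := hs
      show p.1 * s.1 = p.1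
      have h1 : p.1 * (p.1 + q.1 - p.1 * q.1) = p.1 := by
        rw [mul_sub, mul_add, ← mul_assoc, p.2.2.1]; abel
      rw [← h1, mul_assoc, hs]
    · refine Filter.principal_mono.2 ?_
      intro s hs
      have hs : (p.1 + q.1 - p.1 * q.1) * s.1 = p.1 + q.1 - p.1 * q.1 := hs
      show q.1 * s.1 = q.1
      have h1 : q.1 * (p.1 + q.1 - p.1 * q.1) = q.1 := by
        rw [mul_sub, mul_add, ← mul_assoc, ← p.2.1 q.1, mul_assoc, q.2.2.1]; abel
      rw [← h1, mul_assoc, hs]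
  have hne : (⨅ q, 𝓟 (S q)).NeBot := by
    refine Filter.iInf_neBot_of_directed' hdir fun q => ?_
    rw [Filter.principal_neBot_iff]
    exact ⟨q, q.2.2.1⟩
  let U : Ultrafilter X := Ultrafilter.of (⨅ q, 𝓟 (S q))
  have hU : ∀ q : X, ∀ᶠ p : X in (U : Filter X), q.1 * p.1 = q.1 := by
    intro q
    have : (U : Filter X) ≤ 𝓟 (S q) := (Ultrafilter.of_le _).trans (iInf_le _ q)
    exact this (Filter.mem_principal_self _)
  have hlim : ∀ a, ∃ z : ℂ, Tendsto (fun p => t p a) U (nhds z) := by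
    intro a
    have hc : IsCompact (Metric.closedBall (0 : ℂ) ‖a‖) := isCompact_closedBall _ _
    obtain ⟨z, -, hz⟩ := hc.ultrafilter_le_nhds (U.map fun p => t p a) (by
      refine Filter.le_principal_iff.2 (Filter.mem_map.2 (Filter.Eventually.of_forall fun p => ?_))
      simpa using state_bound (t p) (htpos p) (ht1 p) a)
    exact ⟨z, hz⟩
  choose l hl using hlim
  let τ : A →ₗ[ℂ] ℂ :=
    { toFun := l
      map_add' := fun a b => tendsto_nhds_unique (hl (a + b)) (by
        simpa only [map_add] using (hl a).add (hl b))
      map_smul' := fun c a => tendsto_nhds_unique (hl (c • a)) (by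
        simpa only [map_smul, RingHom.id_apply] using (hl a).const_smul c) }
  refine no_trace hnuc hT τ ⟨?_, ?_, ?_⟩ ?_
  · refine tendsto_nhds_unique (hl 1) ?_
    simp only [ht1]
    exact tendsto_const_nhds
  · intro a
    exact ge_of_tendsto' (hl (star a * a)) (fun p => htpos p a)
  · intro a b
    refine tendsto_nhds_unique (hl (a * b)) ?_
    simp only [htt _ a b]
    exact hl (b * a)
  · intro q hq
    refine tendsto_nhds_unique (hl q) (Tendsto.congr' ?_ tendsto_const_nhds)
    filter_upwards [hU ⟨q, hq⟩] with p hp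
    have hp : q * p.1 = q := hp
    obtain ⟨hc, hqq, hqs, -⟩ := hq
    obtain ⟨hpc, hpp, hps, -⟩ := p.2
    have h1 := htpos p q
    rw [hqs, hqq] at h1
    have h2 := htpos p (p.1 - q)
    have h3 : star (p.1 - q) * (p.1 - q) = p.1 - q := by
      rw [star_sub, hqs, hps, sub_mul, mul_sub, mul_sub, hpp, hqq, hpc, hp, sub_self, sub_zero]
    rw [h3, map_sub, ht0, zero_sub] at h2
    exact le_antisymm h1 (by simpa using h2)

lemma starModule_of_nuclear {A : Type*} [NormedRing A] [StarRing A] [CStarRing A]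
    [NormedAlgebra ℂ A] (hnuc : IsNuclear A) : StarModule ℂ A := by
  obtain ⟨k, φ, ψ, hn, hlim⟩ := hnuc
  let c : A := Complex.I • 1
  have hc : ∀ x : A, c * x = x * c := fun x => by simp [c]
  let u : A := star c
  have hu : ∀ x : A, u * x = x * u := fun x => by
    have := congrArg star (hc (star x))
    simpa [u] using this.symm
  have hcc : c * c = -1 := by
    simp [c, smul_smul]
  have huu : u * u = -1 := by
    have := congrArg star hcc
    simpa [u] using this
  let w : A := c * u
  have hww : w * w = 1 := by
    show c * u * (c * u) = 1
    rw [mul_assoc, ← mul_assoc u c u, hu c, mul_assoc c u u, ← mul_assoc, hcc, huu]; simp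
  have hws : star w = w := by
    show star (c * star c) = c * star c
    simp
  have hpos : ∀ n a, (φ n (star a * a)).PosSemidef := by
    intro n a
    have := (hn n).2.1 1 (fun _ => a) (fun _ => 1)
    simpa using this
  have h1 : star (1 - w) * (1 - w) = (2 : ℂ) • (1 - w) := by
    rw [star_sub, hws, star_one, sub_mul, mul_sub, mul_sub, hww, two_smul]; simp; abel
  have h2 : star (c * (1 - w)) * (c * (1 - w)) = -((2 : ℂ) • (1 - w)) := by
    rw [star_mul, mul_assoc, ← mul_assoc (star c), show star c * c = w from hu c, ← mul_assoc,
      star_sub, hws, star_one, sub_mul, sub_mul, mul_sub, mul_sub, hww, two_smul]; simp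
    rw [hww]; abel
  have h0 : (2 : ℂ) • (1 - w) = 0 := by
    have hφ : ∀ n, φ n ((2 : ℂ) • (1 - w)) = 0 := by
      intro n
      have e1 := hpos n (1 - w)
      have e2 := hpos n (c * (1 - w))
      rw [h1] at e1
      rw [h2, map_neg] at e2
      open scoped MatrixOrder in
      exact le_antisymm (neg_nonneg.1 e2.nonneg) e1.nonneg
    have := hlim ((2 : ℂ) • (1 - w))
    simp only [hφ, map_zero, zero_sub, norm_neg] at this
    exact norm_eq_zero.1 (tendsto_nhds_unique tendsto_const_nhds this)
  have hw1 : c * u = 1 := by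
    have := (smul_eq_zero.1 h0).resolve_left two_ne_zero
    exact (sub_eq_zero.1 this).symm
  have huc : u = -c := by
    have := congrArg (c * ·) hw1
    simp only [← mul_assoc, hcc, mul_one] at this
    rw [← this]; simp
  have hI : ∀ x : A, star (Complex.I • x) = -(Complex.I • star x) := by
    intro x
    have : Complex.I • x = c * x := by simp [c]
    rw [this, star_mul, show star c = -c from huc]
    simp [c]
  have hcont : Continuous (star : A → A) :=
    AddMonoidHomClass.continuous_of_bound (starAddEquiv (R := A)).toAddMonoidHom 1 (fun x => by simp)
  have hreal : ∀ (s : ℝ) (x : A), star ((s : ℂ) • x) = (s : ℂ) • star x := by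
    intro s x
    have := map_real_smul (starAddEquiv (R := A)).toAddMonoidHom hcont s x
    simpa using this
  refine ⟨fun z x => ?_⟩
  have hz : z = (z.re : ℂ) + Complex.I * (z.im : ℂ) := by
    rw [mul_comm]; exact (Complex.re_add_im z).symm
  have hz' : star z = (z.re : ℂ) - Complex.I * (z.im : ℂ) := by
    apply Complex.ext <;> simp
  rw [hz']
  conv_lhs => rw [hz]
  rw [add_smul, mul_smul, star_add, hI, hreal, hreal, sub_smul, mul_smul, sub_eq_add_neg]

/-- **Main theorem.** Let `A` be a unital, separable, nuclear C*-algebra with property T.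
Assume (i) every tracial state on a (separable, unital) nuclear C*-algebra is amenable,
(ii) a (separable, unital) C*-algebra with property T and an amenable trace has a nonzero
finite-dimensional quotient, and (iii) every finite-dimensional irreducible representation
of `A` has its Kazhdan projection realized in `A`. Then `A ≅ B ⊕ C` where `B` is finite
dimensional and `C` has no tracial states: there is a central projection `p ∈ A` with
`pA` finite dimensional and no tracial state on the complementary summand `(1-p)A`. -/
theorem nuclear_propertyT_decomposition
    {A : Type} [NormedRing A] [StarRing A] [CStarRing A] [NormedAlgebra ℂ A]
    [CompleteSpace A] [TopologicalSpace.SeparableSpace A]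
    (hnuc : IsNuclear A) (hT : PropertyT A)
    (hAmen : ∀ (B : Type) [NormedRing B] [StarRing B] [CStarRing B] [NormedAlgebra ℂ B]
      [CompleteSpace B] [TopologicalSpace.SeparableSpace B],
      IsNuclear B → ∀ τ : B →ₗ[ℂ] ℂ, IsTracialState τ → IsAmenableTrace τ)
    (hFdQuot : ∀ (B : Type) [NormedRing B] [StarRing B] [CStarRing B] [NormedAlgebra ℂ B]
      [CompleteSpace B] [TopologicalSpace.SeparableSpace B],
      PropertyT B → (∃ τ : B →ₗ[ℂ] ℂ, IsAmenableTrace τ) →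
      ∃ (n : ℕ) (_ : 0 < n) (q : B →⋆ₐ[ℂ] Matrix (Fin n) (Fin n) ℂ), Function.Surjective q)
    (hKaz : ∀ (n : ℕ), 0 < n →
      ∀ π : A →⋆ₐ[ℂ] (EuclideanSpace ℂ (Fin n) →L[ℂ] EuclideanSpace ℂ (Fin n)),
        (∀ S : Submodule ℂ (EuclideanSpace ℂ (Fin n)),
          (∀ (a : A) (x : EuclideanSpace ℂ (Fin n)), x ∈ S → π a x ∈ S) → S = ⊥ ∨ S = ⊤) →
        ∃ p : A, (∀ a : A, p * a = a * p) ∧ p * p = p ∧ star p = p ∧ π p = 1) :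
    ∃ p : A, (∀ a : A, p * a = a * p) ∧ p * p = p ∧ star p = p ∧
      FiniteDimensional ℂ (LinearMap.range (LinearMap.mulLeft ℂ p)) ∧
      ¬∃ τ : A →ₗ[ℂ] ℂ, (∀ a : A, 0 ≤ τ (star a * a)) ∧
        (∀ a b : A, τ (a * b) = τ (b * a)) ∧ τ 1 = 1 ∧ τ p = 0 := by
  have hSM : StarModule ℂ A := starModule_of_nuclear hnuc
  let _ : CStarAlgebra A := { }
  obtain ⟨p, ⟨h1, h2, h3, h4⟩, h5⟩ := main_cstar hnuc hT
  exact ⟨p, h1, h2, h3, h4, h5⟩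
end
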